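/- Suppose there is a constant c₀ > 0 such that β_n ≥ c₀·log n for all sufficiently large n. Then P-almost surely, for every x ∈ (−2,2) one has lim_{L→∞} limsup_{n→∞} #_n[B(x, L/n)]/(2L) = σ(x) and lim_{L→∞} liminf_{n→∞} #_n[B(x, L/n)]/(2L) = σ(x); moreover, almost surely these limits as L → ∞ hold uniformly in x ∈ (−2,2). -/

import Mathlib

open MeasureTheory Filter Topology
open scoped ENNReal

/-- The (unnormalized) density of the Gaussian beta-ensemble with potential `x^2/2`. -/
noncomputable def gaussianDensity (n : ℕ) (β : ℝ) (x : Fin n → ℝ) : ℝ :=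
  (∏ p ∈ Finset.univ.filter (fun p : Fin n × Fin n => p.1 < p.2), |x p.1 - x p.2| ^ β) *
    Real.exp (-((n : ℝ) * β / 2) * ∑ j, (x j) ^ 2 / 2)

/-- The number of points of the configuration `x` lying in the set `I`. -/
noncomputable def countIn (n : ℕ) (x : Fin n → ℝ) (I : Set ℝ) : ℕ :=
  {j : Fin n | x j ∈ I}.ncard

/-- The semicircle density. -/
noncomputable def semicircle (x : ℝ) : ℝ :=
  (2 * Real.pi)⁻¹ * Real.sqrt (max (4 - x ^ 2) 0)

/-- The square root `√(4 - z²)` with positive real part. -/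
noncomputable def rootFour (z : ℂ) : ℂ := Complex.exp (Complex.log (4 - z ^ 2) / 2)

/-- The inverse Joukowsky map of the upper half plane into the lower half disc. -/
noncomputable def joukowskyInv (z : ℂ) : ℂ := (z - Complex.I * rootFour z) / 2

lemma four_sub_sq_mem_slitPlane {z : ℂ} (hz : 0 < z.im) : 4 - z ^ 2 ∈ Complex.slitPlane := by
  rw [Complex.mem_slitPlane_iff]
  by_contra! h
  have h1 : (4 - z ^ 2 : ℂ).re = 4 - z.re ^ 2 + z.im ^ 2 := by
    simp [pow_two]; ring
  have h2 : (4 - z ^ 2 : ℂ).im = - (2 * z.re * z.im) := by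
    simp [pow_two]; ring
  rw [h1, h2] at h
  have h3 : z.re = 0 := by
    have := h.2
    have : z.re * z.im = 0 := by linarith
    rcases mul_eq_zero.1 this with h | h
    · exact h
    · exact absurd h hz.ne'
  rw [h3] at h
  nlinarith [h.1, sq_nonneg z.im]

lemma four_sub_sq_mem_slitPlane_of_real {x : ℝ} (hx : x ∈ Set.Ioo (-2 : ℝ) 2) :
    (4 - (x : ℂ) ^ 2) ∈ Complex.slitPlane := by
  have : (4 - (x : ℂ) ^ 2) = ((4 - x ^ 2 : ℝ) : ℂ) := by push_cast; ring
  rw [this]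
  apply Complex.ofReal_mem_slitPlane.2
  nlinarith [hx.1, hx.2]

lemma rootFour_sq {z : ℂ} (hz : 4 - z ^ 2 ∈ Complex.slitPlane) : rootFour z ^ 2 = 4 - z ^ 2 := by
  rw [rootFour, ← Complex.exp_nat_mul]
  have h : (4 - z ^ 2) ≠ 0 := Complex.slitPlane_ne_zero hz
  rw [show ((2 : ℕ) : ℂ) * (Complex.log (4 - z ^ 2) / 2) = Complex.log (4 - z ^ 2) by
    push_cast; ring, Complex.exp_log h]

lemma rootFour_re_pos {z : ℂ} (hz : 4 - z ^ 2 ∈ Complex.slitPlane) : 0 < (rootFour z).re := by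
  rw [rootFour, Complex.exp_re]
  have h := Complex.mem_slitPlane_iff_arg.1 hz
  have h1 := Complex.neg_pi_lt_arg (4 - z ^ 2)
  have h2 := Complex.arg_le_pi (4 - z ^ 2)
  have h3 : Complex.arg (4 - z ^ 2) < Real.pi := lt_of_le_of_ne h2 h.1
  have e : (Complex.log (4 - z ^ 2) / 2).im = Complex.arg (4 - z ^ 2) / 2 := by
    simp [Complex.log_im]
  rw [e]
  apply mul_pos (Real.exp_pos _)
  apply Real.cos_pos_of_mem_Ioo
  constructor <;> linarith

lemma joukowskyInv_mul {z : ℂ} (hz : 4 - z ^ 2 ∈ Complex.slitPlane) :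
    joukowskyInv z * ((z + Complex.I * rootFour z) / 2) = 1 := by
  have h := rootFour_sq hz
  have : joukowskyInv z * ((z + Complex.I * rootFour z) / 2)
    = (z ^ 2 - Complex.I ^ 2 * rootFour z ^ 2) / 4 := by
    rw [joukowskyInv]; ring
  rw [this, h, Complex.I_sq]; ring

lemma joukowskyInv_ne_zero {z : ℂ} (hz : 0 < z.im) : joukowskyInv z ≠ 0 := by
  intro h
  have := joukowskyInv_mul (four_sub_sq_mem_slitPlane hz)
  rw [h] at this; simp at this

lemma joukowskyInv_inv {z : ℂ} (hz : 0 < z.im) :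
    (joukowskyInv z)⁻¹ = (z + Complex.I * rootFour z) / 2 :=
  inv_eq_of_mul_eq_one_right (joukowskyInv_mul (four_sub_sq_mem_slitPlane hz))

lemma joukowskyInv_add_inv {z : ℂ} (hz : 0 < z.im) :
    joukowskyInv z + (joukowskyInv z)⁻¹ = z := by
  rw [joukowskyInv_inv hz, joukowskyInv]; ring

lemma joukowskyInv_inv_im_pos {z : ℂ} (hz : 0 < z.im) : 0 < ((joukowskyInv z)⁻¹).im := by
  rw [joukowskyInv_inv hz]
  have := rootFour_re_pos (four_sub_sq_mem_slitPlane hz)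
  have e : ((z + Complex.I * rootFour z) / 2).im = (z.im + (rootFour z).re) / 2 := by simp
  rw [e]; linarith

lemma joukowskyInv_im_neg {z : ℂ} (hz : 0 < z.im) : (joukowskyInv z).im < 0 := by
  have h := joukowskyInv_inv_im_pos hz
  rw [Complex.inv_im] at h
  have h2 : 0 < Complex.normSq (joukowskyInv z) :=
    Complex.normSq_pos.2 (joukowskyInv_ne_zero hz)
  by_contra! h3
  have : -(joukowskyInv z).im / Complex.normSq (joukowskyInv z) ≤ 0 :=
    div_nonpos_of_nonpos_of_nonneg (by linarith) h2.le
  linarith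

lemma joukowskyInv_re_im {z : ℂ} (hz : 0 < z.im) :
    let a := (joukowskyInv z).re
    let b := (joukowskyInv z).im
    let p := ‖joukowskyInv z‖ ^ 2
    p = a ^ 2 + b ^ 2 ∧ 0 < p ∧ p < 1 ∧ z.re = a * (1 + 1 / p) ∧ z.im = -b * (1 / p - 1) := by
  intro a b p
  have hp : p = a ^ 2 + b ^ 2 := by
    simp only [p, a, b, Complex.sq_norm, Complex.normSq_apply]; ring
  have hp0 : 0 < p := by
    have := norm_pos_iff.2 (joukowskyInv_ne_zero hz)
    positivity
  have hb : b < 0 := joukowskyInv_im_neg hz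
  have e := joukowskyInv_add_inv hz
  have hre : z.re = a * (1 + 1 / p) := by
    have := congrArg Complex.re e
    rw [Complex.add_re, Complex.inv_re, ← Complex.sq_norm] at this
    rw [← this]; simp only [a, p]; ring
  have him : z.im = -b * (1 / p - 1) := by
    have := congrArg Complex.im e
    rw [Complex.add_im, Complex.inv_im, ← Complex.sq_norm] at this
    rw [← this]; simp only [b, p]; ring
  refine ⟨hp, hp0, ?_, hre, him⟩
  have h1 : 0 < -b * (1 / p - 1) := him ▸ hz
  have h2 : 0 < 1 / p - 1 := by
    by_contra! h; nlinarith
  have h3 : 1 < 1 / p := by linarith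
  rwa [one_lt_div hp0] at h3

lemma norm_joukowskyInv_pos {z : ℂ} (hz : 0 < z.im) : 0 < ‖joukowskyInv z‖ :=
  norm_pos_iff.2 (joukowskyInv_ne_zero hz)

lemma norm_joukowskyInv_lt_one {z : ℂ} (hz : 0 < z.im) : ‖joukowskyInv z‖ < 1 := by
  have h := (joukowskyInv_re_im hz).2.2.1
  have h0 := norm_nonneg (joukowskyInv z)
  nlinarith

lemma im_le_inv_sub_norm_joukowskyInv {z : ℂ} (hz : 0 < z.im) :
    z.im ≤ 1 / ‖joukowskyInv z‖ - ‖joukowskyInv z‖ := by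
  obtain ⟨-, -, h3, -, h5⟩ := joukowskyInv_re_im hz
  have h0 := norm_joukowskyInv_pos hz
  have hb : -(joukowskyInv z).im ≤ ‖joukowskyInv z‖ :=
    (neg_le_abs _).trans (Complex.abs_im_le_norm _)
  rw [h5]
  have h6 : 0 ≤ 1 / ‖joukowskyInv z‖ ^ 2 - 1 := by
    rw [sub_nonneg, le_div_iff₀ (by positivity)]; linarith
  calc _ ≤ ‖joukowskyInv z‖ * (1 / ‖joukowskyInv z‖ ^ 2 - 1) :=
        mul_le_mul_of_nonneg_right hb h6
    _ = _ := by field_simp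

lemma min_le_one_sub_norm_joukowskyInv {z : ℂ} (hz : 0 < z.im) :
    min (1 / 2) (z.im / 4) ≤ 1 - ‖joukowskyInv z‖ := by
  by_cases h : ‖joukowskyInv z‖ ≤ 1 / 2
  · exact (min_le_left _ _).trans (by linarith)
  · push Not at h
    refine (min_le_right _ _).trans ?_
    have h1 := im_le_inv_sub_norm_joukowskyInv hz
    have h2 := norm_joukowskyInv_lt_one hz
    set r := ‖joukowskyInv z‖
    have : 1 / r - r ≤ 4 * (1 - r) := by
      rw [sub_le_iff_le_add, div_le_iff₀ (by linarith)]
      nlinarith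
    linarith

lemma hasDerivAt_joukowskyInv {z : ℂ} (hz : 0 < z.im) :
    HasDerivAt joukowskyInv (joukowskyInv z ^ 2 / (joukowskyInv z ^ 2 - 1)) z := by
  have hs := four_sub_sq_mem_slitPlane hz
  have hs0 : rootFour z ≠ 0 := Complex.exp_ne_zero _
  have hd : HasDerivAt (fun z : ℂ => 4 - z ^ 2) (-(2 * z)) z := by
    simpa using (hasDerivAt_pow 2 z).const_sub 4
  have h1 : HasDerivAt rootFour (rootFour z * (-(2 * z) / (4 - z ^ 2) / 2)) z :=
    ((hd.clog hs).div_const 2).cexp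
  have h2 := (((hasDerivAt_id z).sub (h1.const_mul Complex.I)).div_const 2)
  refine h2.congr_deriv ?_
  have h3 := rootFour_sq hs
  have h4 : joukowskyInv z ^ 2 - 1 = - Complex.I * rootFour z * joukowskyInv z := by
    have := joukowskyInv_mul hs
    rw [← this]; simp only [joukowskyInv]; ring
  rw [h4, ← h3]
  have h5 := joukowskyInv_ne_zero hz
  have h6 : joukowskyInv z ^ 2 / (-Complex.I * rootFour z * joukowskyInv z)
      = Complex.I * joukowskyInv z / rootFour z := by
    field_simp
    rw [Complex.I_sq]
  rw [h6]
  simp only [joukowskyInv]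
  field_simp
  ring_nf
  simp only [Complex.I_sq]
  ring

lemma continuousAt_joukowskyInv_real {x : ℝ} (hx : x ∈ Set.Ioo (-2 : ℝ) 2) :
    ContinuousAt joukowskyInv x := by
  have hs := four_sub_sq_mem_slitPlane_of_real hx
  have h1 : ContinuousAt (fun z : ℂ => 4 - z ^ 2) (x : ℂ) := by fun_prop
  have h2 : ContinuousAt rootFour (x : ℂ) := ((h1.clog hs).div_const 2).cexp
  unfold joukowskyInv
  exact (continuousAt_id.sub (continuousAt_const.mul h2)).div_const 2

lemma joukowskyInv_real_im {x : ℝ} (hx : x ∈ Set.Ioo (-2 : ℝ) 2) :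
    (joukowskyInv x).im = - (Real.sqrt (4 - x ^ 2) / 2) := by
  have h0 : 0 < 4 - x ^ 2 := by nlinarith [hx.1, hx.2]
  have e : (4 - (x : ℂ) ^ 2) = ((4 - x ^ 2 : ℝ) : ℂ) := by push_cast; ring
  have h1 : rootFour x = ((Real.sqrt (4 - x ^ 2) : ℝ) : ℂ) := by
    rw [rootFour, e, ← Complex.ofReal_log h0.le, Real.sqrt_eq_rpow, Real.rpow_def_of_pos h0]
    push_cast; congr 1; ring
  rw [joukowskyInv, h1]
  simp
  ring

/-- The complex logarithmic potential of the semicircle law. -/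
noncomputable def complexPotential (z : ℂ) : ℂ :=
  -Complex.log (joukowskyInv z) + joukowskyInv z ^ 2 / 2

/-- The logarithmic potential of the semicircle law. -/
noncomputable def potential (z : ℂ) : ℝ := (complexPotential z).re

lemma hasDerivAt_complexPotential {z : ℂ} (hz : 0 < z.im) :
    HasDerivAt complexPotential (joukowskyInv z) z := by
  have h := hasDerivAt_joukowskyInv hz
  have hsl : joukowskyInv z ∈ Complex.slitPlane :=
    Complex.mem_slitPlane_iff.2 (Or.inr (joukowskyInv_im_neg hz).ne)
  have h1 := (h.clog hsl).neg.add ((h.pow 2).div_const 2)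
  refine h1.congr_deriv ?_
  have h5 := joukowskyInv_ne_zero hz
  have h6 : joukowskyInv z ^ 2 - 1 ≠ 0 := by
    intro h
    have : joukowskyInv z ^ 2 = 1 := by linear_combination h
    have h7 := congrArg norm this
    rw [norm_pow, norm_one] at h7
    have := norm_joukowskyInv_lt_one hz
    have := norm_nonneg (joukowskyInv z)
    nlinarith
  field_simp
  push_cast
  ring

lemma potential_eq (z : ℂ) :
    potential z = -Real.log ‖joukowskyInv z‖ + (joukowskyInv z ^ 2).re / 2 := by
  simp [potential, complexPotential, Complex.log_re]

lemma abs_potential_sub_le {z w : ℂ} (hz : 0 < z.im) (hw : 0 < w.im) :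
    |potential z - potential w| ≤ ‖z - w‖ := by
  have hc : Convex ℝ {z : ℂ | 0 < z.im} := convex_halfSpace_im_gt 0
  have := hc.norm_image_sub_le_of_norm_hasDerivWithin_le (f := complexPotential)
    (f' := joukowskyInv) (C := 1)
    (fun u hu => (hasDerivAt_complexPotential hu).hasDerivWithinAt)
    (fun u hu => (norm_joukowskyInv_lt_one hu).le) hw hz
  rw [one_mul] at this
  refine le_trans ?_ this
  rw [potential, potential, ← Complex.sub_re]
  exact Complex.abs_re_le_norm _

lemma potential_le_norm_add_one {z : ℂ} (hz : 0 < z.im) : potential z ≤ ‖z‖ + 1 := by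
  rw [potential_eq]
  have h0 := norm_joukowskyInv_pos hz
  have h1 := norm_joukowskyInv_lt_one hz
  have h2 : -Real.log ‖joukowskyInv z‖ ≤ ‖z‖ := by
    rw [← Real.log_inv, ← norm_inv]
    have e : (joukowskyInv z)⁻¹ = z - joukowskyInv z := by
      linear_combination joukowskyInv_add_inv hz
    have h3 := Real.log_le_sub_one_of_pos (norm_pos_iff.2 (inv_ne_zero (joukowskyInv_ne_zero hz)))
    have h4 : ‖(joukowskyInv z)⁻¹‖ ≤ ‖z‖ + ‖joukowskyInv z‖ := by
      rw [e]; exact norm_sub_le _ _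
    linarith
  have h3 : (joukowskyInv z ^ 2).re ≤ 1 := by
    refine (Complex.re_le_norm _).trans ?_
    rw [norm_pow]; nlinarith
  linarith

lemma neg_log_le_half_inv_sub {r : ℝ} (h0 : 0 < r) (h1 : r ≤ 1) :
    -Real.log r ≤ (1 / r - r) / 2 := by
  have h2 : 0 ≤ -Real.log r := by linarith [Real.log_nonpos h0.le h1]
  have := Real.self_le_sinh_iff.2 h2
  rw [Real.sinh_eq, neg_neg, Real.exp_neg, Real.exp_log h0] at this
  rw [one_div]; exact this

lemma potential_le_quadratic {z : ℂ} (hz : 0 < z.im) :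
    potential z ≤ z.re ^ 2 / 4 - 1 / 2 + z.im := by
  obtain ⟨h1, h2, h3, h4, h5⟩ := joukowskyInv_re_im hz
  have h0 := norm_joukowskyInv_pos hz
  have h0' := norm_joukowskyInv_lt_one hz
  have hb := joukowskyInv_im_neg hz
  rw [potential_eq]
  have e : (joukowskyInv z ^ 2).re = (joukowskyInv z).re ^ 2 - (joukowskyInv z).im ^ 2 := by
    simp [pow_two]
  have hbn : -(joukowskyInv z).im ≤ ‖joukowskyInv z‖ :=
    (neg_le_abs _).trans (Complex.abs_im_le_norm _)
  rw [e, h4, h5]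
  set r := ‖joukowskyInv z‖
  set a := (joukowskyInv z).re
  set b := -(joukowskyInv z).im with hbdef
  have hb' : (joukowskyInv z).im = -b := by rw [hbdef]; ring
  rw [hb'] at h1 ⊢
  have l1 := neg_log_le_half_inv_sub h0 h0'.le
  have l2 := neg_log_le_half_inv_sub h2 h3.le
  rw [Real.log_pow] at l2
  push_cast at l2
  obtain ⟨s, hs⟩ : ∃ s, b = s * r := ⟨b / r, by field_simp⟩
  have hs0 : 0 ≤ s := by
    by_contra! h
    nlinarith
  have hs1 : s ≤ 1 := by
    by_contra! h
    nlinarith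
  have ha : a ^ 2 = (1 - s ^ 2) * r ^ 2 := by rw [hs] at h1; linarith
  have l3 : -Real.log r ≤ (1 - s) * ((1 / r ^ 2 - r ^ 2) / 4) + s * ((1 / r - r) / 2) := by
    nlinarith
  have key : (1 - s) * ((1 / r ^ 2 - r ^ 2) / 4) + s * ((1 / r - r) / 2)
      + (a ^ 2 - b ^ 2) / 2 ≤ a ^ 2 * (1 + 1 / r ^ 2) ^ 2 / 4 - 1 / 2 + b * (1 / r ^ 2 - 1) := by
    rw [ha, hs]
    have e : (1 - s ^ 2) * r ^ 2 * (1 + 1 / r ^ 2) ^ 2 / 4 - 1 / 2 + s * r * (1 / r ^ 2 - 1)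
      - ((1 - s) * ((1 / r ^ 2 - r ^ 2) / 4) + s * ((1 / r - r) / 2)
      + ((1 - s ^ 2) * r ^ 2 - (s * r) ^ 2) / 2)
      = s * (1 - s) * (((1 + r ^ 2) ^ 2 - 4 * r ^ 4) / (4 * r ^ 2))
        + s * ((1 - r ^ 2) * (1 - r) / (2 * r)) := by
      field_simp
      ring
    have p1 : 0 ≤ ((1 + r ^ 2) ^ 2 - 4 * r ^ 4) / (4 * r ^ 2) := by
      apply div_nonneg _ (by positivity)
      nlinarith
    have p2 : 0 ≤ (1 - r ^ 2) * (1 - r) / (2 * r) := by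
      apply div_nonneg _ (by positivity)
      apply mul_nonneg <;> nlinarith
    have p3 : 0 ≤ s * (1 - s) := mul_nonneg hs0 (by linarith)
    have := add_nonneg (mul_nonneg p3 p1) (mul_nonneg hs0 p2)
    linarith
  have e2 : (a * (1 + 1 / r ^ 2)) ^ 2 = a ^ 2 * (1 + 1 / r ^ 2) ^ 2 := by ring
  have e3 : (-b) ^ 2 = b ^ 2 := by ring
  rw [e2, e3]
  linarith

section Harnack

variable {F g : ℂ → ℂ} {h : ℝ}

lemma norm_sub_le_norm_add_conj {u a : ℂ} (hu : 0 ≤ u.re) (ha : 0 ≤ a.re) :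
    ‖u - a‖ ≤ ‖u + (starRingEnd ℂ) a‖ := by
  rw [← sq_le_sq₀ (norm_nonneg _) (norm_nonneg _), Complex.sq_norm, Complex.sq_norm,
    Complex.normSq_apply, Complex.normSq_apply]
  simp only [Complex.sub_re, Complex.sub_im, Complex.add_re, Complex.add_im, Complex.conj_re,
    Complex.conj_im]
  nlinarith [mul_nonneg hu ha]

lemma add_conj_ne_zero {u a : ℂ} (hu : 0 < u.re) (ha : 0 < a.re) :
    u + (starRingEnd ℂ) a ≠ 0 := by
  intro h
  have := congrArg Complex.re h
  simp at this
  linarith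

lemma mapsTo_cayley_of_re_pos (hpos : ∀ z ∈ Metric.ball (0 : ℂ) 1, 0 < (F z).re) :
    Set.MapsTo (fun z => (F z - F 0) / (F z + (starRingEnd ℂ) (F 0))) (Metric.ball 0 1)
      (Metric.closedBall 0 1) := by
  have h0 := hpos 0 (by simp)
  intro z hz
  rw [mem_closedBall_zero_iff, norm_div]
  exact div_le_one_of_le₀ (norm_sub_le_norm_add_conj (hpos z hz).le h0.le) (norm_nonneg _)

lemma differentiableOn_cayley_of_re_pos (hd : DifferentiableOn ℂ F (Metric.ball 0 1))
    (hpos : ∀ z ∈ Metric.ball (0 : ℂ) 1, 0 < (F z).re) :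
    DifferentiableOn ℂ (fun z => (F z - F 0) / (F z + (starRingEnd ℂ) (F 0)))
      (Metric.ball 0 1) :=
  (hd.sub_const _).div (hd.add_const _)
    (fun z hz => add_conj_ne_zero (hpos z hz) (hpos 0 (by simp)))

lemma re_mul_one_sub_le_of_re_pos (hd : DifferentiableOn ℂ F (Metric.ball 0 1))
    (hpos : ∀ z ∈ Metric.ball (0 : ℂ) 1, 0 < (F z).re) {z : ℂ} (hz : ‖z‖ < 1) :
    (F z).re * (1 - ‖z‖) ≤ (F 0).re * (1 + ‖z‖) := by
  have hz' : z ∈ Metric.ball (0 : ℂ) 1 := by simpa using hz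
  have h0 := hpos 0 (by simp)
  have h1 := hpos z hz'
  have key := Complex.norm_le_norm_of_mapsTo_ball (differentiableOn_cayley_of_re_pos hd hpos)
    (mapsTo_cayley_of_re_pos hpos) (by simp) hz
  rw [norm_div, div_le_iff₀ (norm_pos_iff.2 (add_conj_ne_zero h1 h0))] at key
  have k2 := pow_le_pow_left₀ (norm_nonneg _) key 2
  rw [mul_pow, Complex.sq_norm, Complex.sq_norm (_ + _), Complex.normSq_apply,
    Complex.normSq_apply] at k2
  simp only [Complex.sub_re, Complex.sub_im, Complex.add_re, Complex.add_im, Complex.conj_re,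
    Complex.conj_im] at k2
  have hr := norm_nonneg z
  have k3 : ((F z).re - (F 0).re) ^ 2 ≤ (‖z‖ * ((F z).re + (F 0).re)) ^ 2 := by
    nlinarith [sq_nonneg ((F z).im - (F 0).im), mul_nonneg (mul_nonneg hr (sub_nonneg.2 hz.le))
      (sq_nonneg ((F z).im - (F 0).im)), mul_nonneg (sub_nonneg.2 hz.le)
      (sq_nonneg ((F z).im - (F 0).im))]
  have k4 := abs_le_of_sq_le_sq' k3 (by positivity)
  linarith [k4.2]

lemma norm_deriv_zero_le_of_re_pos (hd : DifferentiableOn ℂ F (Metric.ball 0 1))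
    (hpos : ∀ z ∈ Metric.ball (0 : ℂ) 1, 0 < (F z).re) :
    ‖deriv F 0‖ ≤ 2 * (F 0).re := by
  have h0 := hpos 0 (by simp)
  have hm := mapsTo_cayley_of_re_pos hpos
  have key := Complex.norm_deriv_le_one_of_mapsTo_ball
    (differentiableOn_cayley_of_re_pos hd hpos) (by simpa using hm) one_pos
  have hF : HasDerivAt F (deriv F 0) 0 :=
    (hd.differentiableAt (Metric.ball_mem_nhds _ one_pos)).hasDerivAt
  have h2 := (hF.sub_const (F 0)).div (hF.add_const ((starRingEnd ℂ) (F 0)))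
    (add_conj_ne_zero h0 h0)
  have e : deriv (fun z => (F z - F 0) / (F z + (starRingEnd ℂ) (F 0))) 0
      = deriv F 0 / (F 0 + (starRingEnd ℂ) (F 0)) := by
    refine h2.deriv.trans ?_
    have := add_conj_ne_zero h0 h0
    field_simp
    ring
  rw [e, norm_div, div_le_one (norm_pos_iff.2 (add_conj_ne_zero h0 h0)), Complex.add_conj] at key
  refine key.trans_eq ?_
  rw [Complex.norm_real, Real.norm_of_nonneg]
  linarith

lemma mul_le_mul_of_forall_pos_add (a b c d : ℝ)
    (H : ∀ ε > 0, (a + ε) * b ≤ (c + ε) * d) : a * b ≤ c * d := by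
  have h1 : Tendsto (fun ε : ℝ => (a + ε) * b) (𝓝[>] 0) (𝓝 ((a + 0) * b)) := by
    apply tendsto_nhdsWithin_of_tendsto_nhds
    apply Continuous.tendsto; fun_prop
  have h2 : Tendsto (fun ε : ℝ => (c + ε) * d) (𝓝[>] 0) (𝓝 ((c + 0) * d)) := by
    apply tendsto_nhdsWithin_of_tendsto_nhds
    apply Continuous.tendsto; fun_prop
  have := le_of_tendsto_of_tendsto h1 h2
    (by filter_upwards [self_mem_nhdsWithin] with ε hε using H ε hε)
  simpa using this

/-- Gradient estimate for a nonnegative harmonic function in a half plane. -/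
lemma norm_deriv_mul_le_of_re_nonneg (hd : ∀ z : ℂ, h < z.im → DifferentiableAt ℂ g z)
    (hpos : ∀ z : ℂ, h < z.im → 0 ≤ (g z).re) {z : ℂ} (hz : h < z.im) :
    ‖deriv g z‖ * (z.im - h) ≤ (g z).re * 2 := by
  have hy : 0 < z.im - h := by linarith
  refine le_of_forall_pos_le_add fun ε hε => ?_
  have hin : ∀ ξ ∈ Metric.ball (0 : ℂ) 1, h < (z + ((z.im - h : ℝ) : ℂ) * ξ).im := by
    intro ξ hξ
    rw [mem_ball_zero_iff] at hξ
    have := (abs_lt.1 ((Complex.abs_im_le_norm ξ).trans_lt hξ)).1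
    rw [Complex.add_im, Complex.im_ofReal_mul]
    nlinarith
  have hD : ∀ ξ ∈ Metric.ball (0 : ℂ) 1, HasDerivAt
      (fun ξ => g (z + ((z.im - h : ℝ) : ℂ) * ξ) + ((ε / 2 : ℝ) : ℂ))
      (deriv g (z + ((z.im - h : ℝ) : ℂ) * ξ) * ((z.im - h : ℝ) : ℂ)) ξ := by
    intro ξ hξ
    have h1 : HasDerivAt (fun ξ : ℂ => z + ((z.im - h : ℝ) : ℂ) * ξ) ((z.im - h : ℝ) : ℂ) ξ := by
      simpa using ((hasDerivAt_id ξ).const_mul ((z.im - h : ℝ) : ℂ)).const_add z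
    exact ((hd _ (hin ξ hξ)).hasDerivAt.comp ξ h1).add_const _
  have key := norm_deriv_zero_le_of_re_pos
    (fun ξ hξ => (hD ξ hξ).differentiableAt.differentiableWithinAt)
    (fun ξ hξ => by
      rw [Complex.add_re, Complex.ofReal_re]
      linarith [hpos _ (hin ξ hξ)])
  rw [(hD 0 (by simp)).deriv] at key
  simp only [mul_zero, add_zero, Complex.add_re, Complex.ofReal_re] at key
  rw [norm_mul, Complex.norm_real, Real.norm_of_nonneg hy.le] at key
  linarith

/-- Harnack inequality in a half plane. -/
lemma harnack_halfPlane (hd : ∀ z : ℂ, h < z.im → DifferentiableAt ℂ g z)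
    (hpos : ∀ z : ℂ, h < z.im → 0 ≤ (g z).re) {z z₀ : ℂ} (hz : h < z.im) (hz₀ : h < z₀.im) :
    (g z).re * ((z.im - h) * (z₀.im - h)) ≤
      (g z₀).re * ((z.re - z₀.re) ^ 2 + (z.im + z₀.im - 2 * h) ^ 2) := by
  have hy : 0 < z.im - h := by linarith
  have hy₀ : 0 < z₀.im - h := by linarith
  refine mul_le_mul_of_forall_pos_add _ _ _ _ fun ε hε => ?_
  set p : ℂ := z₀ - Complex.I * ((z₀.im - h : ℝ) : ℂ) with hp
  have hpre : p.re = z₀.re := by simp [hp]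
  have hpim : p.im = h := by simp [hp]
  have h1ξ : ∀ ξ ∈ Metric.ball (0 : ℂ) 1, 1 - ξ ≠ 0 := by
    intro ξ hξ h0
    rw [mem_ball_zero_iff] at hξ
    rw [sub_eq_zero] at h0
    rw [← h0, norm_one] at hξ
    exact lt_irrefl _ hξ
  let φ : ℂ → ℂ := fun ξ => p + Complex.I * ((z₀.im - h : ℝ) : ℂ) * ((1 + ξ) / (1 - ξ))
  have hin : ∀ ξ ∈ Metric.ball (0 : ℂ) 1, h < (φ ξ).im := by
    intro ξ hξ
    have h2 := h1ξ ξ hξ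
    rw [mem_ball_zero_iff] at hξ
    have e : (φ ξ).im = h + (z₀.im - h) * ((1 + ξ) / (1 - ξ)).re := by
      simp only [φ]
      rw [Complex.add_im, hpim, mul_assoc, Complex.I_mul_im, Complex.re_ofReal_mul]
    rw [e]
    have : 0 < ((1 + ξ) / (1 - ξ)).re := by
      rw [Complex.div_re, ← add_div]
      apply div_pos _ (Complex.normSq_pos.2 h2)
      have : ξ.re ^ 2 + ξ.im ^ 2 < 1 := by
        have := Complex.sq_norm ξ
        rw [Complex.normSq_apply] at this
        nlinarith [norm_nonneg ξ]
      simp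
      nlinarith
    nlinarith [mul_pos hy₀ this]
  have hdφ : DifferentiableOn ℂ (fun ξ => g (φ ξ) + (ε : ℂ)) (Metric.ball 0 1) := by
    intro ξ hξ
    have h2 : DifferentiableAt ℂ φ ξ :=
      ((((differentiableAt_const (1 : ℂ)).add differentiableAt_id).div
        ((differentiableAt_const (1 : ℂ)).sub differentiableAt_id) (h1ξ ξ hξ)).const_mul
          _).const_add _
    exact (((hd _ (hin ξ hξ)).comp ξ h2).add_const _).differentiableWithinAt
  have hposφ : ∀ ξ ∈ Metric.ball (0 : ℂ) 1, 0 < (g (φ ξ) + (ε : ℂ)).re := by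
    intro ξ hξ
    rw [Complex.add_re, Complex.ofReal_re]
    linarith [hpos _ (hin ξ hξ)]
  set q : ℂ := p - Complex.I * ((z₀.im - h : ℝ) : ℂ) with hq
  have hqim : q.im = 2 * h - z₀.im := by simp [hq, hpim]; ring
  have hqre : q.re = z₀.re := by simp [hq, hpre]
  have hzq : z - q ≠ 0 := by
    intro h0
    have := congrArg Complex.im h0
    rw [Complex.sub_im, hqim, Complex.zero_im] at this
    linarith
  set ξ : ℂ := (z - z₀) / (z - q) with hξ
  have n1 : ‖z - q‖ ^ 2 = (z.re - z₀.re) ^ 2 + (z.im + z₀.im - 2 * h) ^ 2 := by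
    rw [Complex.sq_norm, Complex.normSq_apply, Complex.sub_re, Complex.sub_im, hqim, hqre]; ring
  have n2 : ‖z - z₀‖ ^ 2 = ‖z - q‖ ^ 2 - 4 * ((z.im - h) * (z₀.im - h)) := by
    rw [n1, Complex.sq_norm, Complex.normSq_apply, Complex.sub_re, Complex.sub_im]; ring
  have n3 : ‖ξ‖ * ‖z - q‖ = ‖z - z₀‖ := by
    rw [hξ, norm_div]; field_simp [norm_ne_zero_iff.2 hzq]
  have hzq' : 0 < ‖z - q‖ := norm_pos_iff.2 hzq
  have hξ1 : ‖ξ‖ < 1 := by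
    rw [hξ, norm_div, div_lt_one hzq', ← sq_lt_sq₀ (norm_nonneg _) (norm_nonneg _), n2]
    nlinarith [mul_pos hy hy₀]
  have key := re_mul_one_sub_le_of_re_pos hdφ hposφ hξ1
  have hφ0 : φ 0 = z₀ := by simp [φ, hp]
  have hφξ : φ ξ = z := by
    have e1 : 1 + ξ = 2 * (z - p) / (z - q) := by
      rw [hξ, eq_div_iff hzq, add_mul, div_mul_cancel₀ _ hzq, hq, hp]; ring
    have e2 : 1 - ξ = 2 * (Complex.I * ((z₀.im - h : ℝ) : ℂ)) / (z - q) := by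
      rw [hξ, eq_div_iff hzq, sub_mul, div_mul_cancel₀ _ hzq, hq, hp]; ring
    have hne : Complex.I * ((z₀.im - h : ℝ) : ℂ) ≠ 0 :=
      mul_ne_zero Complex.I_ne_zero (Complex.ofReal_ne_zero.2 hy₀.ne')
    simp only [φ]
    rw [e1, e2, div_div_div_cancel_right₀ hzq, mul_div_mul_left _ _ two_ne_zero,
      mul_div_cancel₀ _ hne]
    ring
  simp only [hφ0, hφξ, Complex.add_re, Complex.ofReal_re] at key
  have hu : 0 < (g z).re + ε := by linarith [hpos _ hz]
  have ha : 0 < (g z₀).re + ε := by linarith [hpos _ hz₀]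
  have hr := norm_nonneg ξ
  rw [← n1]
  have k2 : ((g z).re + ε) * (1 - ‖ξ‖ ^ 2) ≤ ((g z₀).re + ε) * 4 := by
    have := mul_le_mul_of_nonneg_right key (by linarith : 0 ≤ 1 + ‖ξ‖)
    have h4 : (1 + ‖ξ‖) ^ 2 ≤ 4 := by nlinarith
    nlinarith [mul_le_mul_of_nonneg_left h4 ha.le]
  have k3 : (1 - ‖ξ‖ ^ 2) * ‖z - q‖ ^ 2 = 4 * ((z.im - h) * (z₀.im - h)) := by
    rw [sub_mul, ← mul_pow, n3, n2]; ring
  have k4 := mul_le_mul_of_nonneg_right k2 (sq_nonneg ‖z - q‖)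
  rw [mul_assoc, k3] at k4
  linarith

end Harnack

section Config

variable {n : ℕ} {C : ℝ}

/-- The complex field of the points other than `x j`, in the semicircle background. -/
noncomputable def complexField (x : Fin n → ℝ) (j : Fin n) (z : ℂ) : ℂ :=
  ∑ k ∈ Finset.univ.erase j, Complex.log (z - x k) - n * complexPotential z

/-- The logarithmic field of the points other than `x j`, in the semicircle background. -/
noncomputable def energyField (x : Fin n → ℝ) (j : Fin n) (z : ℂ) : ℝ :=
  ∑ k ∈ Finset.univ.erase j, Real.log ‖z - x k‖ - n * potential z

/-- The energy of the point `x j` in the field of the other points. -/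
noncomputable def energyWeight (x : Fin n → ℝ) (j : Fin n) : ℝ :=
  ∑ k ∈ Finset.univ.erase j, Real.log |x j - x k| - n * ((x j) ^ 2 / 4 - 1 / 2)

/-- Quasi-Fekete configurations. -/
structure GoodConfig (C : ℝ) (x : Fin n → ℝ) : Prop where
  nonneg : 0 ≤ C
  inj : Function.Injective x
  bdd : ∀ j, |x j| ≤ 8
  weight : ∀ j, -C ≤ energyWeight x j
  field_le : ∀ j, ∀ z : ℂ, 1 / (2 * n : ℝ) ≤ z.im → energyField x j z ≤ C + energyWeight x j

lemma sub_ofReal_mem_slitPlane {z : ℂ} (hz : 0 < z.im) (c : ℝ) : z - c ∈ Complex.slitPlane := by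
  rw [Complex.mem_slitPlane_iff]
  right; simpa using hz.ne'

lemma complexField_re (x : Fin n → ℝ) (j : Fin n) (z : ℂ) :
    (complexField x j z).re = energyField x j z := by
  rw [complexField, energyField, Complex.sub_re, Complex.re_sum]
  simp [Complex.log_re, potential]

lemma hasDerivAt_complexField (x : Fin n → ℝ) (j : Fin n) {z : ℂ} (hz : 0 < z.im) :
    HasDerivAt (complexField x j)
      (∑ k ∈ Finset.univ.erase j, 1 / (z - x k) - n * joukowskyInv z) z := by
  refine HasDerivAt.fun_sub (HasDerivAt.fun_sum fun k _ => ?_)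
    ((hasDerivAt_complexPotential hz).const_mul _)
  exact ((hasDerivAt_id z).sub_const _).clog (sub_ofReal_mem_slitPlane hz _)

lemma norm_mk_sub (t y c : ℝ) : ‖(⟨t, y⟩ : ℂ) - c‖ = Real.sqrt ((t - c) ^ 2 + y ^ 2) := by
  rw [← Real.sqrt_sq (norm_nonneg _), Complex.sq_norm, Complex.normSq_apply]
  congr 1
  simp; ring

lemma norm_mk_self_sub {t y : ℝ} (hy : 0 ≤ y) : ‖(⟨t, y⟩ : ℂ) - t‖ = y := by
  rw [norm_mk_sub]; simp [hy]

lemma abs_sub_le_norm_mk_sub (t y c : ℝ) : |t - c| ≤ ‖(⟨t, y⟩ : ℂ) - c‖ := by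
  simpa using Complex.abs_re_le_norm ((⟨t, y⟩ : ℂ) - c)

lemma im_le_norm_mk_sub (t y c : ℝ) : y ≤ ‖(⟨t, y⟩ : ℂ) - c‖ := by
  have := Complex.abs_im_le_norm ((⟨t, y⟩ : ℂ) - c)
  simp at this
  exact (le_abs_self _).trans this

lemma norm_mk_sub_le {y : ℝ} (t c : ℝ) (hy : 0 ≤ y) : ‖(⟨t, y⟩ : ℂ) - c‖ ≤ |t - c| + y := by
  have := Complex.norm_le_abs_re_add_abs_im ((⟨t, y⟩ : ℂ) - c)
  simp [abs_of_nonneg hy] at this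
  exact this

lemma energyField_add_log (x : Fin n → ℝ) (j : Fin n) (z : ℂ) :
    energyField x j z + Real.log ‖z - x j‖ = ∑ k, Real.log ‖z - x k‖ - n * potential z := by
  rw [energyField, ← Finset.sum_erase_add _ _ (Finset.mem_univ j)]; ring

variable {x : Fin n → ℝ}

lemma n_pos (j : Fin n) : (0 : ℝ) < n := by exact_mod_cast j.pos

lemma log_norm_mono (hx : Function.Injective x) {j k : Fin n} (h : k ∈ Finset.univ.erase j)
    (y : ℝ) : Real.log |x j - x k| ≤ Real.log ‖(⟨x j, y⟩ : ℂ) - x k‖ := by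
  apply Real.log_le_log
  · rw [abs_pos, sub_ne_zero]
    exact fun e => (Finset.ne_of_mem_erase h) (hx e).symm
  · exact abs_sub_le_norm_mk_sub _ _ _

lemma weight_le_field_add (hx : Function.Injective x) (j : Fin n) (y : ℝ) :
    energyWeight x j + n * ((x j) ^ 2 / 4 - 1 / 2) ≤
      energyField x j ⟨x j, y⟩ + n * potential ⟨x j, y⟩ := by
  rw [energyWeight, energyField, sub_add_cancel, sub_add_cancel]
  exact Finset.sum_le_sum fun k hk => log_norm_mono hx hk y

lemma weight_sub_one_le_field (hx : Function.Injective x) (j : Fin n) :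
    energyWeight x j - 1 ≤ energyField x j ⟨x j, 1 / n⟩ := by
  have hn := n_pos j
  have h1 := weight_le_field_add hx j (1 / n)
  have h2 := potential_le_quadratic (z := ⟨x j, 1 / n⟩) (by simpa using hn)
  simp only at h2
  have h3 := mul_le_mul_of_nonneg_left h2 hn.le
  have h4 : (n : ℝ) * (1 / n) = 1 := by field_simp
  rw [mul_add, h4] at h3
  linarith

namespace GoodConfig

lemma le_one_div (j : Fin n) : 1 / (2 * n : ℝ) ≤ 1 / n := by
  have hn := n_pos j
  apply one_div_le_one_div_of_le hn; linarith

/-- Harnack inequality for the defect of the field. -/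
lemma harnack (hg : GoodConfig C x) (j : Fin n) {z z₀ : ℂ} (hz : 1 / (2 * n : ℝ) < z.im)
    (hz₀ : 1 / (2 * n : ℝ) < z₀.im) :
    (C + energyWeight x j - energyField x j z) *
        ((z.im - 1 / (2 * n)) * (z₀.im - 1 / (2 * n))) ≤
      (C + energyWeight x j - energyField x j z₀) *
        ((z.re - z₀.re) ^ 2 + (z.im + z₀.im - 2 * (1 / (2 * n))) ^ 2) := by
  have hn := n_pos j
  have e : ∀ w : ℂ, (((C + energyWeight x j : ℝ) : ℂ) - complexField x j w).re =
      C + energyWeight x j - energyField x j w := fun w => by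
    rw [Complex.sub_re, complexField_re, Complex.ofReal_re]
  have := harnack_halfPlane (g := fun z => ((C + energyWeight x j : ℝ) : ℂ) - complexField x j z)
    (h := 1 / (2 * n : ℝ))
    (fun z hz => ((hasDerivAt_complexField x j
      ((by positivity : (0 : ℝ) < 1 / (2 * n)).trans hz)).const_sub _).differentiableAt)
    (fun z hz => by rw [e]; linarith [hg.field_le j z hz.le]) hz hz₀
  rw [e, e] at this
  exact this

lemma gradient (hg : GoodConfig C x) (j : Fin n) {z : ℂ} (hz : 1 / (2 * n : ℝ) < z.im) :
    ‖n * joukowskyInv z - ∑ k ∈ Finset.univ.erase j, 1 / (z - x k)‖ * (z.im - 1 / (2 * n)) ≤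
      (C + energyWeight x j - energyField x j z) * 2 := by
  have hn := n_pos j
  have e : ∀ w : ℂ, (((C + energyWeight x j : ℝ) : ℂ) - complexField x j w).re =
      C + energyWeight x j - energyField x j w := fun w => by
    rw [Complex.sub_re, complexField_re, Complex.ofReal_re]
  have hd : ∀ z : ℂ, 1 / (2 * n : ℝ) < z.im → HasDerivAt
      (fun z => ((C + energyWeight x j : ℝ) : ℂ) - complexField x j z)
      (-(∑ k ∈ Finset.univ.erase j, 1 / (z - x k) - n * joukowskyInv z)) z :=
    fun z hz => (hasDerivAt_complexField x j
      ((by positivity : (0 : ℝ) < 1 / (2 * n)).trans hz)).const_sub _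
  have := norm_deriv_mul_le_of_re_nonneg (fun z hz => (hd z hz).differentiableAt)
    (fun z hz => by rw [e]; linarith [hg.field_le j z hz.le]) hz
  rwa [e, (hd z hz).deriv, neg_sub] at this

lemma weight_le_field_near (hg : GoodConfig C x) (j : Fin n) {t : ℝ}
    (ht : |t - x j| ≤ 1 / n) :
    energyWeight x j - (7 * C + 8) ≤ energyField x j ⟨t, 1 / n⟩ := by
  have hn := n_pos j
  have h0 := weight_sub_one_le_field hg.inj j
  have hlt : 1 / (2 * n : ℝ) < 1 / n := one_div_lt_one_div_of_lt hn (by linarith)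
  have h1 := hg.harnack j (z := ⟨t, 1 / n⟩) (z₀ := ⟨x j, 1 / n⟩) hlt hlt
  simp only at h1
  have e1 : (1 / n - 1 / (2 * n) : ℝ) * (1 / n - 1 / (2 * n)) = (1 / n) ^ 2 / 4 := by
    field_simp; ring
  have e2 : (1 / n + 1 / n - 2 * (1 / (2 * n)) : ℝ) = 1 / n := by
    field_simp; ring
  rw [e1, e2] at h1
  have h2 : (t - x j) ^ 2 ≤ (1 / n : ℝ) ^ 2 := by
    rw [← sq_abs (t - x j)]; exact pow_le_pow_left₀ (abs_nonneg _) ht 2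
  have h3 : 0 < (1 / n : ℝ) ^ 2 := by positivity
  have hC := hg.nonneg
  set v := C + energyWeight x j - energyField x j ⟨t, 1 / n⟩ with hv
  have h4 : C + energyWeight x j - energyField x j ⟨x j, 1 / n⟩ ≤ C + 1 := by linarith
  have h5 : v * ((1 / n) ^ 2 / 4) ≤ (C + 1) * (2 * (1 / n) ^ 2) := by
    refine h1.trans (mul_le_mul h4 (by linarith) (by positivity) (by linarith))
  have h6 : v ≤ 8 * (C + 1) := by
    have : v * (1 / n : ℝ) ^ 2 ≤ 8 * (C + 1) * (1 / n) ^ 2 := by linarith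
    exact le_of_mul_le_mul_right this h3
  linarith

lemma log_one_add_eq (hn : (0 : ℝ) < n) {d : ℝ} (hd : 0 ≤ d) :
    Real.log (d + 1 / n) = Real.log (1 + n * d) - Real.log n := by
  rw [← Real.log_div (by positivity) hn.ne']
  congr 1; field_simp; ring

lemma log_inv_eq : Real.log (1 / n : ℝ) = - Real.log n := by
  rw [one_div, Real.log_inv]

lemma weight_le_weight (hg : GoodConfig C x) (j k : Fin n) :
    energyWeight x k ≤ energyWeight x j + (C + 1) + Real.log (1 + n * |x k - x j|) := by
  have hn := n_pos j
  have hn' : (0 : ℝ) < 1 / n := by positivity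
  have h0 := weight_sub_one_le_field hg.inj k
  have h1 := hg.field_le j ⟨x k, 1 / n⟩ (le_one_div j)
  have h2 := energyField_add_log x j ⟨x k, 1 / n⟩
  rw [← energyField_add_log x k ⟨x k, 1 / n⟩, norm_mk_self_sub hn'.le, log_inv_eq] at h2
  have h3 : Real.log ‖(⟨x k, 1 / n⟩ : ℂ) - x j‖ ≤ Real.log (1 + n * |x k - x j|) - Real.log n := by
    rw [← log_one_add_eq hn (abs_nonneg _)]
    exact Real.log_le_log (hn'.trans_le (im_le_norm_mk_sub _ _ _)) (norm_mk_sub_le _ _ hn'.le)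
  linarith

lemma weight_le_field_near_other (hg : GoodConfig C x) (j k : Fin n) {t : ℝ}
    (ht : |t - x k| ≤ 1 / n) :
    energyWeight x j - (8 * C + 10) - 2 * Real.log (1 + n * |t - x j|) ≤
      energyField x j ⟨t, 1 / n⟩ := by
  have hn := n_pos j
  have hn' : (0 : ℝ) < 1 / n := by positivity
  have h0 := hg.weight_le_field_near k ht
  have h2 := energyField_add_log x j ⟨t, 1 / n⟩
  rw [← energyField_add_log x k ⟨t, 1 / n⟩] at h2
  have h3 : Real.log ‖(⟨t, 1 / n⟩ : ℂ) - x j‖ ≤ Real.log (1 + n * |t - x j|) - Real.log n := by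
    rw [← log_one_add_eq hn (abs_nonneg _)]
    exact Real.log_le_log (hn'.trans_le (im_le_norm_mk_sub _ _ _)) (norm_mk_sub_le _ _ hn'.le)
  have h4 : - Real.log n ≤ Real.log ‖(⟨t, 1 / n⟩ : ℂ) - x k‖ := by
    rw [← log_inv_eq]
    exact Real.log_le_log hn' (im_le_norm_mk_sub _ _ _)
  have h5 := hg.weight_le_weight k j
  have h6 : Real.log (1 + n * |x j - x k|) ≤ 1 + Real.log (1 + n * |t - x j|) := by
    have e : 1 + Real.log (1 + n * |t - x j|) = Real.log (Real.exp 1 * (1 + n * |t - x j|)) := by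
      rw [Real.log_mul (Real.exp_pos 1).ne' (by positivity), Real.log_exp]
    rw [e]
    apply Real.log_le_log (by positivity)
    have h7 : |x j - x k| ≤ |t - x j| + |t - x k| := by
      rw [abs_sub_comm t (x j)]
      exact (abs_sub_le _ t _)
    have h8 : (n : ℝ) * |x j - x k| ≤ n * |t - x j| + 1 := by
      have := mul_le_mul_of_nonneg_left (h7.trans (add_le_add_right ht _)) hn.le
      rwa [mul_add, mul_one_div_cancel hn.ne'] at this
    have h9 : (2 : ℝ) ≤ Real.exp 1 := by linarith [Real.add_one_le_exp (1 : ℝ)]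
    have h10 : 0 ≤ (n : ℝ) * |t - x j| := by positivity
    nlinarith
  linarith

lemma quadratic_le_potential (hg : GoodConfig C x) (k : Fin n) :
    n * ((x k) ^ 2 / 4 - 1 / 2) ≤ n * potential ⟨x k, 1 / n⟩ + C := by
  have h1 := hg.field_le k ⟨x k, 1 / n⟩ (le_one_div k)
  have h2 := weight_le_field_add hg.inj k (1 / n)
  linarith

end GoodConfig

/-- The logarithmic field at height `1 / n`, compared with the quadratic external field. -/
noncomputable def lineField (x : Fin n → ℝ) (j : Fin n) (t : ℝ) : ℝ :=
  ∑ k ∈ Finset.univ.erase j, Real.log ‖(⟨t, 1 / n⟩ : ℂ) - x k‖ - n * (t ^ 2 / 4 - 1 / 2)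

lemma lineField_le_energyField (j : Fin n) (t : ℝ) :
    lineField x j t - 1 ≤ energyField x j ⟨t, 1 / n⟩ := by
  have hn := n_pos j
  have h2 := potential_le_quadratic (z := ⟨t, 1 / n⟩) (by simpa using hn)
  simp only at h2
  have h3 := mul_le_mul_of_nonneg_left h2 hn.le
  have h4 : (n : ℝ) * (1 / n) = 1 := by field_simp
  rw [mul_add, h4] at h3
  rw [lineField, energyField]
  linarith

lemma GoodConfig.lineField_near (hg : GoodConfig C x) (j k : Fin n) {t : ℝ}
    (ht : |t - x k| ≤ 1 / n) :
    energyWeight x j - (9 * C + 16) ≤ lineField x j t + 2 * Real.log (1 + n * |t - x j|) := by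
  have hn := n_pos j
  have hn' : (0 : ℝ) < 1 / n := by positivity
  have h4 : (n : ℝ) * (1 / n) = 1 := by field_simp
  have h1 := hg.weight_le_field_near_other j k ht
  have h2 : lineField x j t = energyField x j ⟨t, 1 / n⟩
      + n * potential ⟨t, 1 / n⟩ - n * (t ^ 2 / 4 - 1 / 2) := by
    rw [lineField, energyField]; ring
  have h3 := hg.quadratic_le_potential k
  have h5 : potential ⟨x k, 1 / n⟩ - 1 / n ≤ potential ⟨t, 1 / n⟩ := by
    have h6 := abs_potential_sub_le (z := ⟨x k, 1 / n⟩) (w := ⟨t, 1 / n⟩) hn' hn'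
    have e : (⟨x k, 1 / n⟩ : ℂ) - ⟨t, 1 / n⟩ = ((x k - t : ℝ) : ℂ) := by
      apply Complex.ext <;> simp
    rw [e, Complex.norm_real, Real.norm_eq_abs, abs_sub_comm (x k) t] at h6
    linarith [(abs_le.1 h6).2]
  have h7 := mul_le_mul_of_nonneg_left h5 hn.le
  rw [mul_sub, h4] at h7
  have h8 : t ^ 2 / 4 - (x k) ^ 2 / 4 ≤ 5 * (1 / n) := by
    have hb := abs_le.1 (hg.bdd k)
    have hn1 : (1 / n : ℝ) ≤ 1 := by
      rw [div_le_one hn]; exact_mod_cast k.pos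
    have ht' := abs_le.1 ht
    have : t ^ 2 - (x k) ^ 2 = (t - x k) * (t + x k) := by ring
    have h9 : (t - x k) * (t + x k) ≤ 1 / n * 17 := by
      refine (le_abs_self _).trans ?_
      rw [abs_mul]
      refine mul_le_mul ht ?_ (abs_nonneg _) hn'.le
      rw [abs_le]; constructor <;> linarith
    linarith
  have h9 := mul_le_mul_of_nonneg_left h8 hn.le
  have e : (n : ℝ) * (5 * (1 / n)) = 5 := by field_simp
  rw [e] at h9
  linarith

lemma concaveOn_log_norm {l r y c : ℝ} (hy : 0 < y)
    (h : ∀ u ∈ Set.Icc l r, ∀ v ∈ Set.Icc l r, y ^ 2 ≤ (u - c) * (v - c)) :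
    ConcaveOn ℝ (Set.Icc l r) fun s : ℝ => Real.log ‖(⟨s, y⟩ : ℂ) - c‖ := by
  have e : (fun s : ℝ => Real.log ‖(⟨s, y⟩ : ℂ) - c‖)
      = fun s : ℝ => Real.log ((s - c) ^ 2 + y ^ 2) / 2 := by
    funext s
    rw [norm_mk_sub, Real.log_sqrt (by positivity)]
  rw [e]
  have hd : ∀ s : ℝ, HasDerivAt (fun s : ℝ => Real.log ((s - c) ^ 2 + y ^ 2) / 2)
      ((s - c) / ((s - c) ^ 2 + y ^ 2)) s := by
    intro s
    have h1 : HasDerivAt (fun s : ℝ => (s - c) ^ 2 + y ^ 2) (2 * (s - c)) s := by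
      simpa using (((hasDerivAt_id s).sub_const c).pow 2).add_const (y ^ 2)
    refine ((h1.log (by positivity)).div_const 2).congr_deriv ?_
    field_simp
  refine AntitoneOn.concaveOn_of_deriv (convex_Icc l r)
    (fun s _ => (hd s).continuousAt.continuousWithinAt)
    (fun s _ => (hd s).differentiableAt.differentiableWithinAt) ?_
  intro u hu v hv huv
  rw [(hd u).deriv, (hd v).deriv, div_le_div_iff₀ (by positivity) (by positivity)]
  have := h u (interior_subset hu) v (interior_subset hv)
  nlinarith [mul_le_mul_of_nonneg_left this (sub_nonneg.2 huv)]

lemma concaveOn_log_one_add_abs {l r c a : ℝ} (ha : 0 ≤ a)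
    (h : (∀ u ∈ Set.Icc l r, c ≤ u) ∨ (∀ u ∈ Set.Icc l r, u ≤ c)) :
    ConcaveOn ℝ (Set.Icc l r) fun s : ℝ => Real.log (1 + a * |s - c|) := by
  have hlog := strictConcaveOn_log_Ioi.concaveOn
  refine ⟨convex_Icc l r, fun u hu v hv p q hp hq hpq => ?_⟩
  have e : 1 + a * |p • u + q • v - c| = p • (1 + a * |u - c|) + q • (1 + a * |v - c|) := by
    have hm := convex_Icc l r hu hv hp hq hpq
    have e2 : (1 : ℝ) = p * 1 + q * 1 := by linarith
    rcases h with h | h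
    · rw [abs_of_nonneg (sub_nonneg.2 (h _ hu)), abs_of_nonneg (sub_nonneg.2 (h _ hv)),
        abs_of_nonneg (sub_nonneg.2 (h _ hm))]
      simp only [smul_eq_mul]
      linear_combination (1 - a * c) * e2
    · rw [abs_of_nonpos (sub_nonpos.2 (h _ hu)), abs_of_nonpos (sub_nonpos.2 (h _ hv)),
        abs_of_nonpos (sub_nonpos.2 (h _ hm))]
      simp only [smul_eq_mul]
      linear_combination (1 + a * c) * e2
  have := hlog.2 (x := 1 + a * |u - c|) (y := 1 + a * |v - c|)
    (Set.mem_Ioi.2 (by positivity)) (Set.mem_Ioi.2 (by positivity)) hp hq hpq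
  rw [← e] at this
  exact this

lemma GoodConfig.lineField_ge (hg : GoodConfig C x) (j : Fin n) {t : ℝ}
    (h1 : ∃ k, x k ≤ t) (h2 : ∃ k, t ≤ x k) :
    energyWeight x j - (9 * C + 16) ≤ lineField x j t + 2 * Real.log (1 + n * |t - x j|) := by
  by_cases hnear : ∃ k, |t - x k| ≤ 1 / n
  · obtain ⟨k, hk⟩ := hnear
    exact hg.lineField_near j k hk
  push Not at hnear
  have hn := n_pos j
  have hn' : (0 : ℝ) < 1 / n := by positivity
  obtain ⟨a, ha, hamax⟩ := Finset.exists_max_image (Finset.univ.filter fun k => x k ≤ t) x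
    (by obtain ⟨k, hk⟩ := h1; exact ⟨k, by simpa using hk⟩)
  obtain ⟨b, hb, hbmin⟩ := Finset.exists_min_image (Finset.univ.filter fun k => t ≤ x k) x
    (by obtain ⟨k, hk⟩ := h2; exact ⟨k, by simpa using hk⟩)
  simp only [Finset.mem_filter, Finset.mem_univ, true_and] at ha hb hamax hbmin
  have hat : x a + 1 / n < t := by
    have := hnear a
    rw [abs_of_nonneg (by linarith)] at this; linarith
  have hbt : t < x b - 1 / n := by
    have := hnear b
    rw [abs_of_nonpos (by linarith)] at this; linarith
  have hside : ∀ k, x k ≤ x a ∨ x b ≤ x k := by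
    intro k
    rcases le_total (x k) t with h | h
    · exact Or.inl (hamax k h)
    · exact Or.inr (hbmin k h)
  set l := x a + 1 / n with hl
  set r := x b - 1 / n with hr
  have hsum : ConcaveOn ℝ (Set.Icc l r)
      fun s : ℝ => ∑ k ∈ Finset.univ.erase j, Real.log ‖(⟨s, 1 / n⟩ : ℂ) - x k‖ := by
    have : ∀ S : Finset (Fin n), ConcaveOn ℝ (Set.Icc l r)
        fun s : ℝ => ∑ k ∈ S, Real.log ‖(⟨s, 1 / n⟩ : ℂ) - x k‖ := by
      intro S
      induction S using Finset.induction_on with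
      | empty => simpa using concaveOn_const (0 : ℝ) (convex_Icc l r)
      | insert k S hk ih =>
        have := (concaveOn_log_norm (l := l) (r := r) (c := x k) hn' (by
          intro u hu v hv
          rcases hside k with h | h
          · have h1 : 1 / n ≤ u - x k := by linarith [hu.1]
            have h2 : 1 / n ≤ v - x k := by linarith [hv.1]
            rw [pow_two]
            exact mul_le_mul h1 h2 hn'.le (by linarith)
          · have h1 : 1 / n ≤ x k - u := by linarith [hu.2]
            have h2 : 1 / n ≤ x k - v := by linarith [hv.2]
            rw [pow_two, show (u - x k) * (v - x k) = (x k - u) * (x k - v) by ring]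
            exact mul_le_mul h1 h2 hn'.le (by linarith))).add ih
        refine this.congr fun s _ => ?_
        rw [Finset.sum_insert hk, Pi.add_apply]
    exact this _
  have hlog : ConcaveOn ℝ (Set.Icc l r) fun s : ℝ => Real.log (1 + n * |s - x j|) := by
    apply concaveOn_log_one_add_abs hn.le
    rcases hside j with h | h
    · left; intro u hu; linarith [hu.1]
    · right; intro u hu; linarith [hu.2]
  have hquad : ConcaveOn ℝ (Set.Icc l r) fun s : ℝ => -(n * (s ^ 2 / 4 - 1 / 2)) := by
    have h2 : ConvexOn ℝ (Set.Icc l r) fun s : ℝ => s ^ 2 :=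
      (even_two.convexOn_pow).subset (Set.subset_univ _) (convex_Icc l r)
    have h3 := ((h2.smul (c := (n : ℝ) / 4) (by positivity)).neg).add_const ((n : ℝ) / 2)
    refine h3.congr fun s _ => ?_
    simp; ring
  have htot : ConcaveOn ℝ (Set.Icc l r)
      fun s : ℝ => lineField x j s + 2 * Real.log (1 + n * |s - x j|) :=
    ((hsum.add hquad).add (hlog.smul (c := 2) (by norm_num))).congr fun s _ => by
      simp only [Pi.add_apply, lineField, smul_eq_mul]; ring
  have hlr : l ≤ r := by linarith
  have key := htot.min_le_of_mem_Icc (Set.left_mem_Icc.2 hlr) (Set.right_mem_Icc.2 hlr)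
    (z := t) ⟨hat.le, hbt.le⟩
  refine le_trans (le_min ?_ ?_) key
  · apply hg.lineField_near j a
    rw [hl, add_sub_cancel_left, abs_of_pos hn']
  · apply hg.lineField_near j b
    rw [hr, sub_sub_cancel_left, abs_neg, abs_of_pos hn']

lemma GoodConfig.field_ge (hg : GoodConfig C x) (j : Fin n) {t : ℝ}
    (h1 : ∃ k, x k ≤ t) (h2 : ∃ k, t ≤ x k) :
    energyWeight x j - (9 * C + 17) - 2 * Real.log (1 + n * |t - x j|) ≤
      energyField x j ⟨t, 1 / n⟩ := by
  have := hg.lineField_ge j h1 h2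
  have := lineField_le_energyField (x := x) j t
  linarith

end Config

section Hull

lemma neg_log_norm_joukowskyInv_le_sqrt {z : ℂ} (hz : 0 < z.im) (hre : |z.re| ≤ 2) :
    -Real.log ‖joukowskyInv z‖ ≤ Real.sqrt z.im := by
  obtain ⟨h1, h2, h3, h4, h5⟩ := joukowskyInv_re_im hz
  have h0 := norm_joukowskyInv_pos hz
  have hb := joukowskyInv_im_neg hz
  set q := ‖joukowskyInv z‖
  set a := (joukowskyInv z).re
  set b := (joukowskyInv z).im
  have hq1 : q < 1 := by nlinarith
  have hs : 0 < Real.sqrt q := Real.sqrt_pos.2 h0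
  have hs1 : Real.sqrt q ≤ 1 := Real.sqrt_le_one.2 hq1.le
  have hsq : Real.sqrt q ^ 2 = q := Real.sq_sqrt h0.le
  have l1 := neg_log_le_half_inv_sub hs hs1
  rw [Real.log_sqrt h0.le] at l1
  have hy : (1 - q) ^ 2 / q ≤ z.im := by
    have ha : a ^ 2 * (1 + q ^ 2) ^ 2 ≤ 4 * q ^ 4 := by
      have h6 : z.re ^ 2 ≤ 4 := by
        rw [← sq_abs]; nlinarith [abs_nonneg z.re]
      have e : a * (1 + q ^ 2) = z.re * q ^ 2 := by
        rw [h4]; field_simp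
        ring
      calc a ^ 2 * (1 + q ^ 2) ^ 2 = (a * (1 + q ^ 2)) ^ 2 := by ring
        _ = z.re ^ 2 * q ^ 4 := by rw [e]; ring
        _ ≤ 4 * q ^ 4 := by gcongr
    have hb2 : (q * (1 - q ^ 2)) ^ 2 ≤ (-b * (1 + q ^ 2)) ^ 2 := by
      have : (-b * (1 + q ^ 2)) ^ 2 = q ^ 2 * (1 + q ^ 2) ^ 2 - a ^ 2 * (1 + q ^ 2) ^ 2 := by
        rw [h1]; ring
      rw [this]; nlinarith
    have hb3 : q * (1 - q ^ 2) ≤ -b * (1 + q ^ 2) := by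
      have hb0 : 0 ≤ -b * (1 + q ^ 2) := mul_nonneg (by linarith) (by positivity)
      exact (abs_le_of_sq_le_sq' hb2 hb0).2
    rw [h5, div_le_iff₀ h0]
    have e : -b * (1 / q ^ 2 - 1) * q = (-b * (1 + q ^ 2)) * ((1 - q ^ 2) / (q * (1 + q ^ 2))) := by
      field_simp
    rw [e]
    have h7 : 0 ≤ (1 - q ^ 2) / (q * (1 + q ^ 2)) :=
      div_nonneg (by linarith) (by positivity)
    refine le_trans ?_ (mul_le_mul_of_nonneg_right hb3 h7)
    have e2 : q * (1 - q ^ 2) * ((1 - q ^ 2) / (q * (1 + q ^ 2)))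
        = (1 - q) ^ 2 * ((1 + q) ^ 2 / (1 + q ^ 2)) := by
      field_simp
      ring
    rw [e2]
    refine le_mul_of_one_le_right (sq_nonneg _) ?_
    rw [one_le_div (by positivity)]
    nlinarith
  refine Real.le_sqrt_of_sq_le (le_trans ?_ hy)
  have l2 : -Real.log q ≤ 1 / Real.sqrt q - Real.sqrt q := by linarith
  have l3 : 0 ≤ -Real.log q := by linarith [Real.log_nonpos h0.le hq1.le]
  refine (pow_le_pow_left₀ l3 l2 2).trans_eq ?_
  set s := Real.sqrt q
  rw [← hsq]
  field_simp

lemma log_norm_chord {c ρ y u : ℝ} (hρ : 0 < ρ) (hy : 0 < y) {e : ℂ} (he : ‖e‖ = 1) :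
    let Z : ℂ := ⟨2 * (u - c) / ρ, 2 * y / ρ⟩
    Real.log ‖(⟨c + ρ * e.re, y⟩ : ℂ) - u‖ =
      Real.log (ρ / 2) + (Real.log ‖e - joukowskyInv Z‖ + Real.log ‖e - (joukowskyInv Z)⁻¹‖) := by
  intro Z
  have hZ : 0 < Z.im := by simp only [Z]; positivity
  have h1 := joukowskyInv_add_inv hZ
  have hne := joukowskyInv_ne_zero hZ
  have hlt := norm_joukowskyInv_lt_one hZ
  have he0 : e ≠ 0 := by
    intro h; rw [h, norm_zero] at he; norm_num at he
  have hconj : e⁻¹ = (starRingEnd ℂ) e := by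
    rw [Complex.inv_def, ← Complex.sq_norm, he]; simp
  have h2 : ‖(⟨c + ρ * e.re, y⟩ : ℂ) - u‖ = ρ / 2 * ‖e + e⁻¹ - Z‖ := by
    rw [norm_mk_sub, hconj, Complex.add_conj]
    have e3 : (((2 * e.re : ℝ) : ℂ) - Z) = -(⟨2 * (u - c) / ρ - 2 * e.re, 2 * y / ρ⟩ : ℂ) := by
      apply Complex.ext <;> simp [Z]
    rw [e3, norm_neg]
    have e4 : (⟨2 * (u - c) / ρ - 2 * e.re, 2 * y / ρ⟩ : ℂ)
        = ⟨2 * (u - c) / ρ, 2 * y / ρ⟩ - ((2 * e.re : ℝ) : ℂ) := by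
      apply Complex.ext <;> simp
    rw [e4, norm_mk_sub]
    rw [← Real.sqrt_sq (by positivity : 0 ≤ ρ / 2), ← Real.sqrt_mul (by positivity)]
    congr 1
    field_simp
    ring
  have h3 : e + e⁻¹ - Z = (e - joukowskyInv Z) * (e - (joukowskyInv Z)⁻¹) * e⁻¹ := by
    have : e + e⁻¹ - (joukowskyInv Z + (joukowskyInv Z)⁻¹)
        = (e - joukowskyInv Z) * (e - (joukowskyInv Z)⁻¹) * e⁻¹ := by field_simp; ring
    rwa [h1] at this
  have h4 : e - joukowskyInv Z ≠ 0 := by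
    intro h
    rw [sub_eq_zero] at h
    rw [← h, he] at hlt; exact lt_irrefl _ hlt
  have h5 : e - (joukowskyInv Z)⁻¹ ≠ 0 := by
    intro h
    rw [sub_eq_zero] at h
    rw [h, norm_inv] at he
    rw [inv_eq_one.1 he] at hlt; exact lt_irrefl _ hlt
  rw [h2, h3, norm_mul, norm_mul, norm_inv, he, inv_one, mul_one,
    Real.log_mul (by positivity) (mul_ne_zero (norm_ne_zero_iff.2 h4) (norm_ne_zero_iff.2 h5)),
    Real.log_mul (norm_ne_zero_iff.2 h4) (norm_ne_zero_iff.2 h5)]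

lemma circleAverage_log_norm_chord {c ρ y u : ℝ} (hρ : 0 < ρ) (hy : 0 < y) :
    Real.circleAverage (fun e : ℂ => Real.log ‖(⟨c + ρ * e.re, y⟩ : ℂ) - u‖) 0 1 =
      Real.log (ρ / 2) - Real.log ‖joukowskyInv ⟨2 * (u - c) / ρ, 2 * y / ρ⟩‖ := by
  set Z : ℂ := ⟨2 * (u - c) / ρ, 2 * y / ρ⟩ with hZdef
  have hZ : 0 < Z.im := by simp only [hZdef]; positivity
  have hpos := norm_joukowskyInv_pos hZ
  have hlt := norm_joukowskyInv_lt_one hZ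
  rw [Real.circleAverage_congr_sphere (f₂ := fun e => Real.log (ρ / 2) +
    (Real.log ‖e - joukowskyInv Z‖ + Real.log ‖e - (joukowskyInv Z)⁻¹‖))
    (fun e he => log_norm_chord hρ hy (by simpa using he))]
  rw [Real.circleAverage_fun_add (circleIntegrable_const _ _ _)
      ((circleIntegrable_log_norm_sub_const 1).fun_add (circleIntegrable_log_norm_sub_const 1)),
    Real.circleAverage_fun_add (circleIntegrable_log_norm_sub_const 1)
      (circleIntegrable_log_norm_sub_const 1), Real.circleAverage_const,
    circleAverage_log_norm_sub_const_eq_posLog, circleAverage_log_norm_sub_const_eq_posLog,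
    (Real.posLog_eq_zero_iff _).2 (by simpa using hlt.le), norm_inv,
    Real.posLog_eq_log (by
      rw [abs_of_nonneg (by positivity)]; exact (one_le_inv₀ hpos).2 hlt.le), Real.log_inv]
  ring

lemma circleAverage_quadratic (c ρ : ℝ) :
    Real.circleAverage (fun e : ℂ => (c + ρ * e.re) ^ 2) 0 1 = c ^ 2 + ρ ^ 2 / 2 := by
  rw [Real.circleAverage_def]
  have e : ∀ θ : ℝ, (c + ρ * (circleMap 0 1 θ).re) ^ 2
      = c ^ 2 + 2 * c * ρ * Real.cos θ + ρ ^ 2 * Real.cos θ ^ 2 := by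
    intro θ
    have : (circleMap 0 1 θ).re = Real.cos θ := by
      simp [circleMap, Complex.exp_ofReal_mul_I_re]
    rw [this]; ring
  simp only [e]
  rw [intervalIntegral.integral_add, intervalIntegral.integral_add,
    intervalIntegral.integral_const_mul, intervalIntegral.integral_const_mul, integral_cos,
    integral_cos_sq]
  · simp
    field_simp
  all_goals exact Continuous.intervalIntegrable (by fun_prop) _ _

variable {n : ℕ} {C : ℝ} {x : Fin n → ℝ}

lemma continuous_log_norm_mk_sub {f : ℂ → ℝ} (hf : Continuous f) {y : ℝ} (hy : 0 < y) (u : ℝ) :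
    Continuous fun e : ℂ => Real.log ‖(⟨f e, y⟩ : ℂ) - u‖ := by
  have : Continuous fun e : ℂ => ‖(⟨f e, y⟩ : ℂ) - u‖ := by
    simp only [norm_mk_sub]; fun_prop
  exact this.log fun e => (hy.trans_le (im_le_norm_mk_sub _ _ _)).ne'

lemma circleAverage_lineField (j : Fin n) {c ρ : ℝ} (hρ : 0 < ρ) :
    Real.circleAverage (fun e : ℂ => lineField x j (c + ρ * e.re)) 0 1 =
      ∑ k ∈ Finset.univ.erase j, (Real.log (ρ / 2) -
        Real.log ‖joukowskyInv ⟨2 * (x k - c) / ρ, 2 * (1 / n) / ρ⟩‖) -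
      n * ((c ^ 2 + ρ ^ 2 / 2) / 4 - 1 / 2) := by
  have hn := n_pos j
  have hn' : (0 : ℝ) < 1 / n := by positivity
  have hc : Continuous fun e : ℂ => c + ρ * e.re := by fun_prop
  have hcont := fun k => continuous_log_norm_mk_sub hc hn' (x k)
  unfold lineField
  rw [Real.circleAverage_fun_sub, Real.circleAverage_fun_sum]
  · simp_rw [circleAverage_log_norm_chord hρ hn']
    congr 1
    have e : (fun e : ℂ => (n : ℝ) * ((c + ρ * e.re) ^ 2 / 4 - 1 / 2))
        = fun e : ℂ => ((n : ℝ) / 4) • (c + ρ * e.re) ^ 2 + (-(n / 2) : ℝ) := by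
      funext e; simp only [smul_eq_mul]; ring
    rw [e, Real.circleAverage_fun_add, Real.circleAverage_fun_smul, circleAverage_quadratic,
      Real.circleAverage_const]
    · simp only [smul_eq_mul]; ring
    · exact (Continuous.continuousOn (by fun_prop)).circleIntegrable'
    · exact circleIntegrable_const _ _ _
  · exact fun k _ => (hcont k).continuousOn.circleIntegrable'
  · exact (Continuous.continuousOn (continuous_finsetSum _ fun k _ => hcont k)).circleIntegrable'
  · exact (Continuous.continuousOn (by fun_prop)).circleIntegrable'

namespace GoodConfig

lemma energyWeight_le_sum_chord (hg : GoodConfig C x) (j a b : Fin n) {c ρ : ℝ}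
    (hc : c = (x a + x b) / 2) (hρ' : ρ = (x b - x a) / 2) (hρ : 0 < ρ) :
    energyWeight x j - (9 * C + 16) - 2 * Real.log (1 + n * 16) ≤
      ∑ k ∈ Finset.univ.erase j, (Real.log (ρ / 2) -
        Real.log ‖joukowskyInv ⟨2 * (x k - c) / ρ, 2 * (1 / n) / ρ⟩‖) -
      n * ((c ^ 2 + ρ ^ 2 / 2) / 4 - 1 / 2) := by
  have hn := n_pos j
  have hn' : (0 : ℝ) < 1 / n := by positivity
  rw [← circleAverage_lineField j hρ]
  rw [← Real.circleAverage_const (energyWeight x j - (9 * C + 16) - 2 * Real.log (1 + n * 16)) 0 1]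
  have hc' : Continuous fun e : ℂ => c + ρ * e.re := by fun_prop
  have hcont : Continuous fun e : ℂ => lineField x j (c + ρ * e.re) := by
    unfold lineField
    exact (continuous_finsetSum _ fun k _ => continuous_log_norm_mk_sub hc' hn' (x k)).sub
      (by fun_prop)
  refine Real.circleAverage_mono (circleIntegrable_const _ _ _)
    hcont.continuousOn.circleIntegrable' fun e he => ?_
  have he : ‖e‖ = 1 := by simpa using he
  have hre := abs_le.1 ((Complex.abs_re_le_norm e).trans_eq he)
  have hle : x a ≤ c + ρ * e.re := by
    rw [hc]; nlinarith
  have hge : c + ρ * e.re ≤ x b := by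
    rw [hc]; nlinarith
  have := hg.lineField_ge j ⟨a, hle⟩ ⟨b, hge⟩
  have hlog : Real.log (1 + n * |c + ρ * e.re - x j|) ≤ Real.log (1 + n * 16) := by
    apply Real.log_le_log (by positivity)
    have h1 := abs_le.1 (hg.bdd a)
    have h2 := abs_le.1 (hg.bdd b)
    have h3 := abs_le.1 (hg.bdd j)
    have : |c + ρ * e.re - x j| ≤ 16 := by
      rw [abs_le]; constructor <;> linarith
    gcongr
  linarith

lemma width_lower (hg : GoodConfig C x) (a b : Fin n) (ha : ∀ k, x a ≤ x k)
    (hb : ∀ k, x k ≤ x b) (hn : 2 * C + 2 < n) : 1 / 6 ≤ (x b - x a) / 2 := by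
  by_contra! h
  have hn0 := n_pos a
  have h1 := hg.weight a
  have hterm : ∀ k ∈ Finset.univ.erase a, Real.log |x a - x k| ≤ -1 := by
    intro k hk
    have hne : x a - x k ≠ 0 := by
      rw [sub_ne_zero]; exact fun e => (Finset.ne_of_mem_erase hk) (hg.inj e).symm
    rw [Real.log_le_iff_le_exp (abs_pos.2 hne)]
    have h3 : |x a - x k| ≤ 1 / 3 := by
      rw [abs_le]; constructor <;> linarith [ha k, hb k, hb a]
    refine h3.trans ?_
    rw [Real.exp_neg, ← one_div]
    apply one_div_le_one_div_of_le (Real.exp_pos 1)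
    linarith [Real.exp_one_lt_d9]
  have h2 := Finset.sum_le_sum hterm
  rw [Finset.sum_const, Finset.card_erase_of_mem (Finset.mem_univ a), Finset.card_univ,
    Fintype.card_fin, nsmul_eq_mul, Nat.cast_sub a.pos, Nat.cast_one] at h2
  rw [energyWeight] at h1
  have h3 : -(n * ((x a) ^ 2 / 4 - 1 / 2)) ≤ (n : ℝ) / 2 := by
    have : 0 ≤ (n : ℝ) * (x a) ^ 2 := by positivity
    linarith
  linarith

lemma hull_bound (hg : GoodConfig C x) (j a b : Fin n) (ha : ∀ k, x a ≤ x k)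
    (hb : ∀ k, x k ≤ x b) (hn : 2 * C + 2 < n) :
    energyWeight x j + n * ((x a + x b) / 2) ^ 2 / 4 + n * ((x b - x a) / 4 - 1) ^ 2 / 2 ≤
      9 * C + 17 + 2 * Real.log (1 + n * 16) + 4 * Real.sqrt n := by
  have hn0 := n_pos j
  have hn' : (0 : ℝ) < 1 / n := by positivity
  have hw := hg.width_lower a b ha hb hn
  obtain ⟨c, hc⟩ : ∃ c, c = (x a + x b) / 2 := ⟨_, rfl⟩
  obtain ⟨ρ, hρ'⟩ : ∃ ρ, ρ = (x b - x a) / 2 := ⟨_, rfl⟩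
  rw [← hρ'] at hw
  have hρ : 0 < ρ := by linarith
  have key := hg.energyWeight_le_sum_chord j a b hc hρ' hρ
  have hterm : ∀ k ∈ Finset.univ.erase j, Real.log (ρ / 2) -
        Real.log ‖joukowskyInv ⟨2 * (x k - c) / ρ, 2 * (1 / n) / ρ⟩‖
        ≤ (ρ / 2 - 1) + Real.sqrt (12 / n) := by
    intro k _
    have l1 := Real.log_le_sub_one_of_pos (by positivity : 0 < ρ / 2)
    have l2 := neg_log_norm_joukowskyInv_le_sqrt
      (z := ⟨2 * (x k - c) / ρ, 2 * (1 / n) / ρ⟩) (by simp only; positivity) (by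
        simp only
        rw [abs_div, abs_of_pos hρ, div_le_iff₀ hρ, abs_le]
        constructor <;> linarith [ha k, hb k])
    have l3 : Real.sqrt (2 * (1 / n) / ρ) ≤ Real.sqrt (12 / n) := by
      apply Real.sqrt_le_sqrt
      rw [div_le_iff₀ hρ]
      have : (12 / n : ℝ) * ρ = 12 * ρ * (1 / n) := by ring
      rw [this]
      gcongr
      linarith
    simp only at l2
    linarith
  have h2 := Finset.sum_le_sum hterm
  rw [Finset.sum_const, Finset.card_erase_of_mem (Finset.mem_univ j), Finset.card_univ,
    Fintype.card_fin, nsmul_eq_mul, Nat.cast_sub j.pos, Nat.cast_one] at h2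
  have h3 : ((n : ℝ) - 1) * Real.sqrt (12 / n) ≤ 4 * Real.sqrt n := by
    have e1 : Real.sqrt (12 / n) ≤ 4 / Real.sqrt n := by
      rw [Real.sqrt_div (by norm_num)]
      gcongr
      rw [Real.sqrt_le_left (by norm_num)]; norm_num
    have hs : 0 < Real.sqrt n := Real.sqrt_pos.2 hn0
    have e2 : (n : ℝ) * (4 / Real.sqrt n) = 4 * Real.sqrt n := by
      field_simp
      rw [Real.sq_sqrt hn0.le]
    have e3 := mul_le_mul_of_nonneg_left e1 hn0.le
    have e4 := Real.sqrt_nonneg (12 / (n : ℝ))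
    linarith
  have e1 : (x b - x a) / 4 = ρ / 2 := by rw [hρ']; ring
  rw [e1, ← hc]
  linarith

end GoodConfig

end Hull

section Barrier

variable {n : ℕ} {C : ℝ} {x : Fin n → ℝ}

lemma joukowskyInv_imaginary {s : ℝ} (h0 : 0 < s) (h1 : s < 1) :
    joukowskyInv ⟨0, 1 / s - s⟩ = -Complex.I * s := by
  have hz : 0 < (⟨0, 1 / s - s⟩ : ℂ).im := by
    simp only
    rw [sub_pos, lt_div_iff₀ h0]; nlinarith
  have e := joukowskyInv_add_inv hz
  have hne := joukowskyInv_ne_zero hz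
  have hlt := norm_joukowskyInv_lt_one hz
  set ζ := joukowskyInv ⟨0, 1 / s - s⟩
  have hs : (s : ℂ) ≠ 0 := by exact_mod_cast h0.ne'
  have e2 : (⟨0, 1 / s - s⟩ : ℂ) = Complex.I * (1 / s - s) := by
    apply Complex.ext
    · simp [← Complex.ofReal_inv]
    · simp [← Complex.ofReal_inv]
  rw [e2] at e
  have e3 : (ζ + Complex.I * s) * (s * ζ - Complex.I) = 0 := by
    have : ζ ^ 2 + 1 = Complex.I * (1 / s - s) * ζ := by
      rw [← e]; field_simp
    have h4 : (s : ℂ) * (ζ ^ 2 + 1) = Complex.I * (1 - s ^ 2) * ζ := by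
      rw [this]; field_simp
    linear_combination h4 - s * Complex.I_sq
  rcases mul_eq_zero.1 e3 with h | h
  · linear_combination h
  · exfalso
    have h5 : (s : ℂ) * ζ = Complex.I := by linear_combination h
    have h6 := congrArg norm h5
    rw [norm_mul, Complex.norm_real, Real.norm_of_nonneg h0.le, Complex.norm_I] at h6
    nlinarith [norm_nonneg ζ]

lemma potential_imaginary {s : ℝ} (h0 : 0 < s) (h1 : s < 1) :
    potential ⟨0, 1 / s - s⟩ = -Real.log s - s ^ 2 / 2 := by
  rw [potential_eq, joukowskyInv_imaginary h0 h1, norm_mul, Complex.norm_real,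
    Real.norm_of_nonneg h0.le, norm_neg, Complex.norm_I, one_mul, mul_pow, neg_sq, Complex.I_sq]
  simp [pow_two]; ring

lemma energyField_imaginary_ge (j : Fin n) {s : ℝ} (h0 : 0 < s) (h1 : s ≤ 1 / 2) :
    Real.log s - 2 * n * s ^ 2 ≤ energyField x j ⟨0, 1 / s - s⟩ := by
  have hn := n_pos j
  have hs2 : s ^ 2 ≤ 1 / 4 := by nlinarith
  rw [energyField, potential_imaginary h0 (by linarith)]
  have hterm : ∀ k ∈ Finset.univ.erase j, -(2 * s ^ 2) - Real.log s ≤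
      Real.log ‖(⟨0, 1 / s - s⟩ : ℂ) - x k‖ := by
    intro k _
    have hp : 0 < 1 / s - s := by
      rw [sub_pos, lt_div_iff₀ h0]; nlinarith
    refine le_trans ?_ (Real.log_le_log hp (im_le_norm_mk_sub 0 _ (x k)))
    have e : 1 / s - s = (1 - s ^ 2) / s := by field_simp
    rw [e, Real.log_div (by nlinarith) h0.ne']
    have h2 := Real.one_sub_inv_le_log_of_pos (by nlinarith : 0 < 1 - s ^ 2)
    have h3 : -(2 * s ^ 2) ≤ 1 - (1 - s ^ 2)⁻¹ := by
      have h4 : (1 - s ^ 2)⁻¹ ≤ 1 + 2 * s ^ 2 := by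
        rw [inv_le_iff_one_le_mul₀ (by nlinarith)]
        nlinarith
      linarith
    linarith
  have h2 := Finset.sum_le_sum hterm
  rw [Finset.sum_const, Finset.card_erase_of_mem (Finset.mem_univ j), Finset.card_univ,
    Fintype.card_fin, nsmul_eq_mul, Nat.cast_sub j.pos, Nat.cast_one] at h2
  have h3 : 0 ≤ n * s ^ 2 := by positivity
  have h4 := sq_nonneg s
  linarith

namespace GoodConfig

lemma harnack_bulk (hg : GoodConfig C x) (j : Fin n) {s : ℝ} (h0 : 0 < s) (h1 : s ≤ 1 / 4)
    (hw : C + energyWeight x j - Real.log s ≤ n * s ^ 2) {z : ℂ} (hre : |z.re| ≤ 3)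
    (him : 1 / (2 * n : ℝ) < z.im) (him2 : z.im ≤ 2) :
    (C + energyWeight x j - energyField x j z) * (z.im - 1 / (2 * n)) ≤ 24 * n * s := by
  have hn := n_pos j
  have hn1 : (1 : ℝ) ≤ n := by exact_mod_cast j.pos
  have hh : 1 / (2 * n : ℝ) ≤ 1 / 2 := by
    apply one_div_le_one_div_of_le <;> linarith
  have hh0 : 0 < 1 / (2 * n : ℝ) := by positivity
  set y₀ := 1 / s - s with hy₀
  have hy3 : 3 ≤ y₀ := by
    have : 4 ≤ 1 / s := by rw [le_div_iff₀ h0]; linarith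
    linarith
  have hv : C + energyWeight x j - energyField x j ⟨0, y₀⟩ ≤ 3 * n * s ^ 2 := by
    have := energyField_imaginary_ge (x := x) j h0 (by linarith)
    linarith
  have key := hg.harnack j (z₀ := ⟨0, y₀⟩) him (by simp only; linarith)
  simp only at key
  set h := 1 / (2 * n : ℝ)
  set v := C + energyWeight x j - energyField x j z
  have hz2 : (z.re - 0) ^ 2 + (z.im + y₀ - 2 * h) ^ 2 ≤ 4 * y₀ ^ 2 := by
    have h3 := abs_le.1 hre
    have : z.re ^ 2 ≤ 9 := by nlinarith
    have h4 : (z.im + y₀ - 2 * h) ^ 2 ≤ (2 + y₀) ^ 2 := by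
      apply pow_le_pow_left₀ <;> linarith
    nlinarith
  have hys : y₀ * s ≤ 1 := by
    rw [hy₀, sub_mul, one_div, inv_mul_cancel₀ h0.ne']; nlinarith
  have k2 : v * ((z.im - h) * (y₀ - h)) ≤ 3 * n * s ^ 2 * (4 * y₀ ^ 2) :=
    key.trans (mul_le_mul hv hz2 (by positivity) (by positivity))
  have hp : 0 < y₀ - h := by linarith
  have k3 : 3 * n * s ^ 2 * (4 * y₀ ^ 2) ≤ 24 * n * s * (y₀ - h) := by
    have : 3 * n * s ^ 2 * (4 * y₀ ^ 2) = 12 * n * s * y₀ * (y₀ * s) := by ring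
    rw [this]
    have h5 : 12 * n * s * y₀ * (y₀ * s) ≤ 12 * n * s * y₀ * 1 := by gcongr
    refine h5.trans ?_
    have h6 : y₀ ≤ 2 * (y₀ - h) := by linarith
    have h7 : 0 ≤ 12 * (n : ℝ) * s := by positivity
    nlinarith [mul_le_mul_of_nonneg_left h6 h7]
  have k4 : v * (z.im - h) * (y₀ - h) ≤ 24 * n * s * (y₀ - h) := by
    rw [mul_assoc]; exact k2.trans k3
  exact le_of_mul_le_mul_right k4 hp

end GoodConfig

lemma re_I_div_sub {z c : ℂ} : (Complex.I / (z - c)).re = (z.im - c.im) / ‖z - c‖ ^ 2 := by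
  rw [Complex.div_re, Complex.sq_norm]
  simp

lemma log_one_add_le_log_norm {d : ℝ} :
    Real.log (1 + |d|) ≤ 1 + Real.log ‖(⟨d, 2⟩ : ℂ)‖ := by
  have h1 : ‖(⟨d, 2⟩ : ℂ)‖ = Real.sqrt (d ^ 2 + 2 ^ 2) := by
    have := norm_mk_sub d 2 0
    simpa using this
  have h2 : 0 < Real.sqrt (d ^ 2 + 2 ^ 2) := Real.sqrt_pos.2 (by positivity)
  have e : 1 + Real.log ‖(⟨d, 2⟩ : ℂ)‖ = Real.log (Real.exp 1 * ‖(⟨d, 2⟩ : ℂ)‖) := by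
    rw [Real.log_mul (Real.exp_pos 1).ne' (by rw [h1]; exact h2.ne'), Real.log_exp]
  rw [e, h1]
  apply Real.log_le_log (by positivity)
  have h9 : (2 : ℝ) ≤ Real.exp 1 := by linarith [Real.add_one_le_exp (1 : ℝ)]
  generalize hS : Real.sqrt (d ^ 2 + 2 ^ 2) = S at h2 ⊢
  have h3 : (1 + |d|) / 2 ≤ S := by
    rw [← hS]
    apply Real.le_sqrt_of_sq_le
    nlinarith [sq_abs d, sq_nonneg (|d| - 1)]
  nlinarith

/-- Local upper bound, up to the real axis, for the defect of the field. -/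
lemma GoodConfig.barrier (hg : GoodConfig C x) (j : Fin n) {x₀ δ M : ℝ} (hx₀ : |x₀| ≤ 2)
    (hδ : 0 < δ) (hδ1 : δ ≤ 1) (hl : ∃ k, x k ≤ x₀ - δ) (hr : ∃ k, x₀ + δ ≤ x k) (hM0 : 0 ≤ M)
    (hM : ∀ z : ℂ, |z.re| ≤ 3 → 1 / (2 * n : ℝ) < z.im → z.im ≤ 2 →
      (C + energyWeight x j - energyField x j z) * (z.im - 1 / (2 * n)) ≤ M)
    {z : ℂ} (hz : 1 / n < z.im) (hzx : ‖z - ⟨x₀, 1 / (2 * n)⟩‖ ≤ δ / 2) :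
    C + energyWeight x j - energyField x j z ≤ 10 * C + 19 + 2 * Real.log (1 + n * ‖z - x j‖) +
      8 * M * (z.im - 1 / (2 * n)) / δ ^ 2 := by
  have hn := n_pos j
  have hn1 : (1 : ℝ) ≤ n := by exact_mod_cast j.pos
  have hh2 : 1 / (2 * n : ℝ) ≤ 1 / 2 := by
    apply one_div_le_one_div_of_le <;> linarith
  have hlt : 1 / (2 * n : ℝ) < 1 / n := one_div_lt_one_div_of_lt hn (by linarith)
  have hh0 : 0 < 1 / (2 * n : ℝ) := by positivity
  have hC := hg.nonneg
  set h := 1 / (2 * n : ℝ) with hh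
  set p : ℂ := ⟨x₀, h⟩ with hp
  set c₁ : ℂ := ⟨x₀ - δ, h⟩ with hc₁
  set c₂ : ℂ := ⟨x₀ + δ, h⟩ with hc₂
  let br : ℂ → ℝ := fun w => (w.im - h) / ‖w - c₁‖ ^ 2 + (w.im - h) / ‖w - c₂‖ ^ 2
  let lg : ℂ → ℝ := fun w => Real.log ‖n * (w - x j) + Complex.I‖
  let G : ℂ → ℂ := fun w => ((C + energyWeight x j : ℝ) : ℂ) - complexField x j w -
    (((10 * C + 19 : ℝ) : ℂ) + 2 * Complex.log (n * (w - x j) + Complex.I) +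
      (M : ℂ) * (Complex.I / (w - c₁) + Complex.I / (w - c₂)))
  have hGre : ∀ w, (G w).re = C + energyWeight x j - energyField x j w -
      (10 * C + 19 + 2 * lg w + M * br w) := by
    intro w
    simp only [G, br, lg]
    rw [Complex.sub_re, Complex.sub_re, Complex.ofReal_re, complexField_re, Complex.add_re,
      Complex.add_re, Complex.ofReal_re, Complex.re_ofReal_mul, Complex.add_re, re_I_div_sub,
      re_I_div_sub, show (2 : ℂ) = ((2 : ℝ) : ℂ) by norm_num, Complex.re_ofReal_mul,
      Complex.log_re]
  have hne : ∀ w : ℂ, h < w.im → ∀ c : ℂ, c.im = h → w - c ≠ 0 := by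
    intro w hw c hc e
    rw [sub_eq_zero] at e
    rw [e, hc] at hw; exact lt_irrefl _ hw
  have hGd : ∀ w : ℂ, h < w.im → DifferentiableAt ℂ G w := by
    intro w hw
    have hw0 : 0 < w.im := hh0.trans hw
    have him : (n * (w - x j) + Complex.I).im = n * w.im + 1 := by simp
    have d1 := (hasDerivAt_complexField x j hw0).differentiableAt
    have d2 : DifferentiableAt ℂ (fun w : ℂ => Complex.log (n * (w - x j) + Complex.I)) w := by
      apply DifferentiableAt.clog (by fun_prop)
      rw [Complex.mem_slitPlane_iff]; right
      rw [him]; positivity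
    have d3 : ∀ c : ℂ, c.im = h → DifferentiableAt ℂ (fun w : ℂ => Complex.I / (w - c)) w :=
      fun c hc => (differentiableAt_const _).div (differentiableAt_id.sub_const _)
        (hne w hw c hc)
    exact ((d1.const_sub _)).sub (((d2.const_mul _).const_add _).add
      (((d3 c₁ rfl).add (d3 c₂ rfl)).const_mul _))
  have hlg0 : ∀ w : ℂ, 0 < w.im → 0 ≤ lg w := by
    intro w hw
    apply Real.log_nonneg
    have him : (n * (w - x j) + Complex.I).im = n * w.im + 1 := by simp
    refine le_trans ?_ ((le_abs_self _).trans (Complex.abs_im_le_norm _))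
    rw [him]
    have : 0 ≤ n * w.im := by positivity
    linarith
  have hbr0 : ∀ w : ℂ, h < w.im → 0 ≤ br w := by
    intro w hw
    have : 0 ≤ w.im - h := by linarith
    simp only [br]; positivity
  let U : Set ℂ := Metric.ball p δ ∩ {w | 1 / (n : ℝ) < w.im}
  have hUo : IsOpen U := Metric.isOpen_ball.inter (isOpen_lt continuous_const Complex.continuous_im)
  have hUcl : closure U ⊆ Metric.closedBall p δ ∩ {w | 1 / (n : ℝ) ≤ w.im} := by
    apply closure_minimal
    · intro w hw
      exact ⟨Metric.ball_subset_closedBall hw.1, show 1 / (n : ℝ) ≤ w.im from le_of_lt hw.2⟩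
    · exact Metric.isClosed_closedBall.inter
        (isClosed_le continuous_const Complex.continuous_im)
  have hUcl' : ∀ w ∈ closure U, h < w.im := fun w hw => hlt.trans_le (hUcl hw).2
  have hUb : Bornology.IsBounded U := Metric.isBounded_ball.subset Set.inter_subset_left
  have hfr : ∀ w ∈ frontier U, ‖Complex.exp (G w)‖ ≤ 1 := by
    intro w hw
    rw [hUo.frontier_eq] at hw
    obtain ⟨hw1, hw2⟩ := hw
    have hwim := hUcl' w hw1
    obtain ⟨hw3, hw4⟩ := hUcl hw1
    rw [Complex.norm_exp, Real.exp_le_one_iff, hGre, sub_nonpos]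
    rw [mem_closedBall_iff_norm] at hw3
    have hwp : ‖w - p‖ ^ 2 = (w.re - x₀) ^ 2 + (w.im - h) ^ 2 := by
      rw [Complex.sq_norm, Complex.normSq_apply]; simp [hp]; ring
    have hwre : |w.re - x₀| ≤ δ := by
      have := (Complex.abs_re_le_norm (w - p)).trans hw3
      simpa [hp] using this
    have hwre' := abs_le.1 hwre
    have hb := mul_nonneg hM0 (hbr0 w hwim)
    have hlgw := hlg0 w (hh0.trans hwim)
    by_cases hcase : w.im = 1 / n
    · have e : w = ⟨w.re, 1 / n⟩ := Complex.ext rfl hcase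
      obtain ⟨kl, hkl⟩ := hl
      obtain ⟨kr, hkr⟩ := hr
      have h1 := hg.field_ge j (t := w.re) ⟨kl, by linarith⟩ ⟨kr, by linarith⟩
      rw [← e] at h1
      have h2 : Real.log (1 + n * |w.re - x j|) ≤ 1 + lg w := by
        have h3 := log_one_add_le_log_norm (d := n * (w.re - x j))
        rw [abs_mul, abs_of_pos hn] at h3
        have e2 : (⟨n * (w.re - x j), 2⟩ : ℂ) = n * (w - x j) + Complex.I := by
          apply Complex.ext
          · simp
          · simp [hcase, hn.ne']; norm_num
        rw [e2] at h3
        exact h3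
      linarith
    · have hwim2 : 1 / (n : ℝ) < w.im := lt_of_le_of_ne hw4 (Ne.symm hcase)
      have hd : ‖w - p‖ = δ := by
        by_contra hne'
        exact hw2 ⟨by rw [mem_ball_iff_norm]; exact lt_of_le_of_ne hw3 hne', hwim2⟩
      rw [hd] at hwp
      have hpos : 0 < w.im - h := by linarith
      have hw_im_le : w.im - h ≤ δ := by nlinarith [sq_nonneg (w.re - x₀)]
      have hbr : br w = 1 / (w.im - h) := by
        have n1 : ‖w - c₁‖ ^ 2 = 2 * δ * (δ + (w.re - x₀)) := by
          have : ‖w - c₁‖ ^ 2 = (w.re - x₀ + δ) ^ 2 + (w.im - h) ^ 2 := by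
            rw [Complex.sq_norm, Complex.normSq_apply]; simp [hc₁]; ring
          rw [this]; linarith
        have n2 : ‖w - c₂‖ ^ 2 = 2 * δ * (δ - (w.re - x₀)) := by
          have : ‖w - c₂‖ ^ 2 = (w.re - x₀ - δ) ^ 2 + (w.im - h) ^ 2 := by
            rw [Complex.sq_norm, Complex.normSq_apply]; simp [hc₂]; ring
          rw [this]; linarith
        have hprod : (δ + (w.re - x₀)) * (δ - (w.re - x₀)) = (w.im - h) ^ 2 := by linarith
        have h1 : 0 < (δ + (w.re - x₀)) * (δ - (w.re - x₀)) := by rw [hprod]; positivity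
        have h2 : δ + (w.re - x₀) ≠ 0 := left_ne_zero_of_mul h1.ne'
        have h3 : δ - (w.re - x₀) ≠ 0 := right_ne_zero_of_mul h1.ne'
        simp only [br]
        rw [n1, n2]
        have : (w.im - h) / (2 * δ * (δ + (w.re - x₀))) + (w.im - h) / (2 * δ * (δ - (w.re - x₀)))
            = (w.im - h) / ((δ + (w.re - x₀)) * (δ - (w.re - x₀))) := by
          field_simp; ring
        rw [this, hprod, pow_two, div_mul_cancel_left₀ hpos.ne', one_div]
      have hx' := abs_le.1 hx₀
      have h1 := hM w (by rw [abs_le]; constructor <;> linarith) hwim (by linarith)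
      have h2 : C + energyWeight x j - energyField x j w ≤ M * br w := by
        rw [hbr, mul_one_div, le_div_iff₀ hpos]; exact h1
      linarith
  have hzU : z ∈ U := ⟨by rw [mem_ball_iff_norm]; linarith, hz⟩
  have hdiff : DiffContOnCl ℂ (fun w => Complex.exp (G w)) U := by
    apply DifferentiableOn.diffContOnCl
    exact fun w hw => (hGd w (hUcl' w hw)).cexp.differentiableWithinAt
  have key := Complex.norm_le_of_forall_mem_frontier_norm_le hUb hdiff hfr (subset_closure hzU)
  rw [Complex.norm_exp, Real.exp_le_one_iff, hGre, sub_nonpos] at key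
  have hzh : 0 < z.im - h := by linarith
  have hlgz : lg z ≤ Real.log (1 + n * ‖z - x j‖) := by
    apply Real.log_le_log
    · have him : (n * (z - x j) + Complex.I).im = n * z.im + 1 := by simp
      rw [norm_pos_iff]
      intro e
      rw [e, Complex.zero_im] at him
      have : 0 < n * z.im := mul_pos hn (by linarith)
      linarith
    · refine (norm_add_le _ _).trans ?_
      rw [Complex.norm_I, norm_mul, Complex.norm_natCast, add_comm]
  have hbrz : br z ≤ 8 * (z.im - h) / δ ^ 2 := by
    have hc : ∀ c : ℂ, ‖p - c‖ = δ → (z.im - h) / ‖z - c‖ ^ 2 ≤ 4 * (z.im - h) / δ ^ 2 := by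
      intro c hc
      have h1 : δ / 2 ≤ ‖z - c‖ := by
        have := norm_sub_le_norm_sub_add_norm_sub p z c
        rw [hc, norm_sub_rev p z] at this
        linarith
      have h2 : (δ / 2) ^ 2 ≤ ‖z - c‖ ^ 2 := pow_le_pow_left₀ (by positivity) h1 2
      rw [div_le_div_iff₀ (by nlinarith) (by positivity)]
      nlinarith
    have e1 := hc c₁ (by
      have : p - c₁ = (δ : ℂ) := by apply Complex.ext <;> simp [hp, hc₁]
      rw [this, Complex.norm_real, Real.norm_of_nonneg hδ.le])
    have e2 := hc c₂ (by
      have : p - c₂ = ((-δ : ℝ) : ℂ) := by apply Complex.ext <;> simp [hp, hc₂]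
      rw [this, Complex.norm_real, Real.norm_eq_abs, abs_neg, abs_of_pos hδ])
    have e3 : 8 * (z.im - h) / δ ^ 2 = 4 * (z.im - h) / δ ^ 2 + 4 * (z.im - h) / δ ^ 2 := by ring
    rw [e3]
    exact add_le_add e1 e2
  have h3 := mul_le_mul_of_nonneg_left hbrz hM0
  have e4 : M * (8 * (z.im - h) / δ ^ 2) = 8 * M * (z.im - h) / δ ^ 2 := by ring
  rw [e4] at h3
  linarith

/-- The Poisson sum of a configuration. -/
noncomputable def poissonSum (x : Fin n → ℝ) (y t : ℝ) : ℝ := ∑ k, y / ((t - x k) ^ 2 + y ^ 2)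

lemma GoodConfig.poissonSum_close (hg : GoodConfig C x) (j : Fin n) {x₀ δ M : ℝ} (hx₀ : |x₀| ≤ 2)
    (hδ : 0 < δ) (hδ1 : δ ≤ 1) (hl : ∃ k, x k ≤ x₀ - δ) (hr : ∃ k, x₀ + δ ≤ x k) (hM0 : 0 ≤ M)
    (hM : ∀ z : ℂ, |z.re| ≤ 3 → 1 / (2 * n : ℝ) < z.im → z.im ≤ 2 →
      (C + energyWeight x j - energyField x j z) * (z.im - 1 / (2 * n)) ≤ M)
    {t y : ℝ} (hy : 1 / n < y) (hyt : |t - x₀| + y ≤ δ / 2) :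
    |poissonSum x y t + n * (joukowskyInv ⟨t, y⟩).im| ≤
      (4 * (10 * C + 19 + 2 * Real.log (1 + n * (|t - x j| + y))) + 1) / y +
        16 * M / δ ^ 2 := by
  have hn := n_pos j
  have hn' : (0 : ℝ) < 1 / n := by positivity
  have hlt : 1 / (2 * n : ℝ) < 1 / n := one_div_lt_one_div_of_lt hn (by linarith)
  have hhalf : 1 / (2 * n : ℝ) = 1 / n / 2 := by field_simp
  have hy0 : 0 < y := hn'.trans hy
  set z : ℂ := ⟨t, y⟩ with hzdef
  have hzx : ‖z - ⟨x₀, 1 / (2 * n)⟩‖ ≤ δ / 2 := by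
    refine (Complex.norm_le_abs_re_add_abs_im _).trans ?_
    simp only [hzdef, Complex.sub_re, Complex.sub_im]
    rw [abs_of_pos (by linarith : 0 < y - 1 / (2 * n))]
    linarith
  have hb := hg.barrier j hx₀ hδ hδ1 hl hr hM0 hM (z := z) hy hzx
  have hgrad := hg.gradient j (z := z) (hlt.trans hy)
  have hzim : z.im = y := rfl
  rw [hzim] at hb hgrad
  have hlog : Real.log (1 + n * ‖z - x j‖) ≤ Real.log (1 + n * (|t - x j| + y)) := by
    apply Real.log_le_log (by positivity)
    have := norm_mk_sub_le t (x j) hy0.le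
    gcongr
  have hyh : y / 2 ≤ y - 1 / (2 * n) := by rw [hhalf]; linarith
  have hyh0 : 0 < y - 1 / (2 * n) := by linarith
  set B := 10 * C + 19 + 2 * Real.log (1 + n * (|t - x j| + y)) with hB
  have hB0 : 0 ≤ B := by
    have := hg.nonneg
    have h1 : 0 ≤ (n : ℝ) * (|t - x j| + y) := by positivity
    have := Real.log_nonneg (by linarith : 1 ≤ 1 + n * (|t - x j| + y))
    positivity
  set D := ‖n * joukowskyInv z - ∑ k ∈ Finset.univ.erase j, 1 / (z - x k)‖ with hD
  have h1 : D ≤ 4 * B / y + 16 * M / δ ^ 2 := by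
    have h2 : D * (y - 1 / (2 * n)) ≤ (4 * B / y + 16 * M / δ ^ 2) * (y - 1 / (2 * n)) := by
      refine hgrad.trans ?_
      have h3 : 2 * B ≤ 4 * B / y * (y - 1 / (2 * n)) := by
        have := mul_le_mul_of_nonneg_left hyh (by positivity : 0 ≤ 4 * B / y)
        have e : 4 * B / y * (y / 2) = 2 * B := by field_simp; ring
        linarith
      have e : 8 * M * (y - 1 / (2 * n)) / δ ^ 2 * 2 = 16 * M / δ ^ 2 * (y - 1 / (2 * n)) := by
        ring
      rw [add_mul]
      linarith
    exact le_of_mul_le_mul_right h2 hyh0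
  have hterm : ∀ k, (1 / (z - x k)).im = - (y / ((t - x k) ^ 2 + y ^ 2)) := by
    intro k
    rw [one_div, Complex.inv_im, Complex.normSq_apply]
    simp [hzdef, pow_two, neg_div]
  have h4 : |n * (joukowskyInv z).im - (∑ k ∈ Finset.univ.erase j, 1 / (z - x k)).im| ≤ D := by
    have := Complex.abs_im_le_norm (n * joukowskyInv z - ∑ k ∈ Finset.univ.erase j, 1 / (z - x k))
    rw [Complex.sub_im, show (n * joukowskyInv z : ℂ).im = n * (joukowskyInv z).im by simp] at this
    exact this
  rw [Complex.im_sum] at h4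
  simp only [hterm, Finset.sum_neg_distrib, sub_neg_eq_add] at h4
  have h5 : poissonSum x y t = ∑ k ∈ Finset.univ.erase j, y / ((t - x k) ^ 2 + y ^ 2)
      + y / ((t - x j) ^ 2 + y ^ 2) := by
    rw [poissonSum, Finset.sum_erase_add _ _ (Finset.mem_univ j)]
  have h6 : y / ((t - x j) ^ 2 + y ^ 2) ≤ 1 / y := by
    rw [div_le_div_iff₀ (by positivity) hy0]; nlinarith [sq_nonneg (t - x j)]
  have h7 : 0 ≤ y / ((t - x j) ^ 2 + y ^ 2) := by positivity
  have h8 := abs_le.1 h4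
  rw [h5, abs_le, add_div]
  have h9 : 0 < 1 / y := by positivity
  constructor <;> linarith

end Barrier

section Tauberian

variable {n : ℕ}

lemma hasDerivAt_arctan_div {y : ℝ} (hy : 0 < y) (c t : ℝ) :
    HasDerivAt (fun t => Real.arctan ((t - c) / y)) (y / ((t - c) ^ 2 + y ^ 2)) t := by
  have h1 : HasDerivAt (fun t : ℝ => (t - c) / y) (1 / y) t :=
    ((hasDerivAt_id t).sub_const c).div_const y
  have h2 := h1.arctan
  convert h2 using 1
  have : (0 : ℝ) < y ^ 2 + (t - c) ^ 2 := by positivity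
  have : (0 : ℝ) < (t - c) ^ 2 + y ^ 2 := by positivity
  field_simp
  ring

/-- Sums of Poisson kernels over part of the points, as derivatives of sums of arctangents. -/
lemma hasDerivAt_sum_arctan (x : Fin n → ℝ) {y : ℝ} (hy : 0 < y) (s : Finset (Fin n)) (t : ℝ) :
    HasDerivAt (fun t => ∑ k ∈ s, Real.arctan ((t - x k) / y))
      (∑ k ∈ s, y / ((t - x k) ^ 2 + y ^ 2)) t :=
  HasDerivAt.fun_sum fun k _ => hasDerivAt_arctan_div hy (x k) t

lemma countIn_Ioo_eq (x : Fin n → ℝ) (c r : ℝ) :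
    countIn n x (Set.Ioo (c - r) (c + r)) =
      (Finset.univ.filter fun k => |x k - c| < r).card := by
  rw [countIn, ← Set.ncard_coe_finset]
  congr 1
  ext k
  simp only [Set.mem_ofPred_eq, Set.mem_Ioo, Finset.coe_filter, Finset.mem_univ, true_and, abs_lt]
  constructor <;> rintro ⟨h1, h2⟩ <;> constructor <;> linarith

lemma pi_div_two_sub_le_arctan {u κ : ℝ} (hκ : 0 < κ) (hu : 1 / κ ≤ u) :
    Real.pi / 2 - κ ≤ Real.arctan u := by
  have h1 : Real.arctan κ ≤ κ := by
    have h := Real.lt_tan (Real.arctan_pos.2 hκ) (Real.arctan_lt_pi_div_two κ)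
    rw [Real.tan_arctan] at h
    exact h.le
  have h2 := Real.arctan_inv_of_pos hκ
  have h3 := Real.arctan_strictMono.monotone hu
  rw [one_div, h2] at h3
  linarith

lemma count_le_of_poissonSum_le (x : Fin n → ℝ) {c r κ B : ℝ} (hr : 0 < r) (hκ : 0 < κ)
    (h : ∀ t, |t - c| ≤ r * (1 + κ) → poissonSum x (κ ^ 2 * r) t ≤ B) :
    (countIn n x (Set.Ioo (c - r) (c + r)) : ℝ) * (Real.pi - 2 * κ) ≤ 2 * r * (1 + κ) * B := by
  have hy : 0 < κ ^ 2 * r := by positivity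
  set y := κ ^ 2 * r with hyd
  set a := c - r * (1 + κ) with ha
  set b := c + r * (1 + κ) with hb
  have hab : a ≤ b := by
    have : 0 ≤ r * (1 + κ) := by positivity
    linarith
  let g : ℝ → ℝ := fun t => ∑ k, Real.arctan ((t - x k) / y)
  have hd : ∀ t, HasDerivAt g (poissonSum x y t) t := fun t =>
    hasDerivAt_sum_arctan x hy Finset.univ t
  have hu : g b - g a ≤ B * (b - a) := by
    apply Convex.image_sub_le_mul_sub_of_deriv_le (convex_Icc a b)
      (fun t _ => (hd t).continuousAt.continuousWithinAt)
      (fun t _ => (hd t).differentiableAt.differentiableWithinAt) _ a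
      (Set.left_mem_Icc.2 hab) b (Set.right_mem_Icc.2 hab) hab
    intro t ht
    rw [(hd t).deriv]
    rw [interior_Icc] at ht
    apply h
    rw [abs_le]; constructor <;> linarith [ht.1, ht.2]
  have hl : (countIn n x (Set.Ioo (c - r) (c + r)) : ℝ) * (Real.pi - 2 * κ) ≤ g b - g a := by
    rw [countIn_Ioo_eq, ← nsmul_eq_mul, ← Finset.sum_const, ← Finset.sum_sub_distrib]
    refine le_trans (Finset.sum_le_sum (g := fun k => Real.arctan ((b - x k) / y) -
      Real.arctan ((a - x k) / y)) ?_) (Finset.sum_le_univ_sum_of_nonneg ?_)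
    · intro k hk
      have hk' := abs_lt.1 (Finset.mem_filter.1 hk).2
      have e1 := pi_div_two_sub_le_arctan (u := (b - x k) / y) hκ (by
        rw [div_le_div_iff₀ hκ hy]
        have : κ * (κ * r) ≤ κ * (b - x k) := by
          apply mul_le_mul_of_nonneg_left _ hκ.le; linarith
        linarith [this, show κ * (κ * r) = y by rw [hyd]; ring])
      have e2 := pi_div_two_sub_le_arctan (u := -((a - x k) / y)) hκ (by
        rw [← neg_div, div_le_div_iff₀ hκ hy]
        have : κ * (κ * r) ≤ κ * -(a - x k) := by
          apply mul_le_mul_of_nonneg_left _ hκ.le; linarith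
        linarith [this, show κ * (κ * r) = y by rw [hyd]; ring])
      rw [Real.arctan_neg] at e2
      linarith
    · intro k
      have : (a - x k) / y ≤ (b - x k) / y := by gcongr
      linarith [Real.arctan_strictMono.monotone this]
  have : B * (b - a) = 2 * r * (1 + κ) * B := by rw [ha, hb]; ring
  linarith

lemma le_count_of_le_poissonSum (x : Fin n → ℝ) {c r κ A B : ℝ} (hr : 0 < r) (hκ : 0 < κ)
    (hκ1 : κ ≤ 1)
    (h : ∀ t, |t - c| ≤ r → A ≤ poissonSum x (κ ^ 2 * r) t)
    (h' : ∀ t, |t - c| ≤ r → poissonSum x (κ * r) t ≤ B) :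
    2 * r * (1 - κ) * (A - 2 * κ * B) ≤
      (countIn n x (Set.Ioo (c - r) (c + r)) : ℝ) * Real.pi := by
  have hy : 0 < κ ^ 2 * r := by positivity
  have hτ : 0 < κ * r := by positivity
  set a := c - r * (1 - κ) with ha
  set b := c + r * (1 - κ) with hb
  have hκr : 0 ≤ r * (1 - κ) := mul_nonneg hr.le (by linarith)
  have hab : a ≤ b := by linarith
  set s := Finset.univ.filter fun k => |x k - c| < r with hs
  let g : ℝ → ℝ := fun t => ∑ k ∈ s, Real.arctan ((t - x k) / (κ ^ 2 * r))
  have hd := fun t => hasDerivAt_sum_arctan x hy s t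
  have hl : (A - 2 * κ * B) * (b - a) ≤ g b - g a := by
    apply Convex.mul_sub_le_image_sub_of_le_deriv (convex_Icc a b)
      (fun t _ => (hd t).continuousAt.continuousWithinAt)
      (fun t _ => (hd t).differentiableAt.differentiableWithinAt) _ a
      (Set.left_mem_Icc.2 hab) b (Set.right_mem_Icc.2 hab) hab
    intro t ht
    rw [(hd t).deriv]
    rw [interior_Icc] at ht
    have htc : |t - c| < r * (1 - κ) := by
      rw [abs_lt]; constructor <;> linarith [ht.1, ht.2]
    have hrr : |t - c| ≤ r := htc.le.trans (by nlinarith)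
    have h1 := h t hrr
    have h2 := h' t hrr
    rw [poissonSum, ← Finset.sum_filter_add_sum_filter_not Finset.univ
      (fun k => |x k - c| < r)] at h1
    have h3 : ∑ k ∈ Finset.univ.filter (fun k => ¬ |x k - c| < r),
        κ ^ 2 * r / ((t - x k) ^ 2 + (κ ^ 2 * r) ^ 2) ≤ 2 * κ * poissonSum x (κ * r) t := by
      rw [poissonSum, Finset.mul_sum]
      refine (Finset.sum_le_sum (g := fun k => 2 * κ * (κ * r / ((t - x k) ^ 2 + (κ * r) ^ 2)))
        ?_).trans (Finset.sum_le_univ_sum_of_nonneg fun k => by positivity)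
      intro k hk
      have hk' := not_lt.1 (Finset.mem_filter.1 hk).2
      have hd1 : κ * r ≤ |t - x k| := by
        have := abs_sub_abs_le_abs_sub (x k - c) (t - c)
        rw [show x k - c - (t - c) = -(t - x k) by ring, abs_neg] at this
        linarith
      have hd2 : (κ * r) ^ 2 ≤ (t - x k) ^ 2 := by
        rw [← sq_abs (t - x k)]; exact pow_le_pow_left₀ hτ.le hd1 2
      have hd3 : 0 < (t - x k) ^ 2 := lt_of_lt_of_le (by positivity) hd2
      calc κ ^ 2 * r / ((t - x k) ^ 2 + (κ ^ 2 * r) ^ 2)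
          ≤ κ ^ 2 * r / (((t - x k) ^ 2 + (κ * r) ^ 2) / 2) := by
            apply div_le_div_of_nonneg_left hy.le (by positivity)
            nlinarith [sq_nonneg (κ ^ 2 * r)]
        _ = _ := by field_simp
    have h4 : 2 * κ * poissonSum x (κ * r) t ≤ 2 * κ * B := by gcongr
    linarith
  have hu : g b - g a ≤ (countIn n x (Set.Ioo (c - r) (c + r)) : ℝ) * Real.pi := by
    rw [countIn_Ioo_eq, ← nsmul_eq_mul, ← Finset.sum_const, ← Finset.sum_sub_distrib]
    refine Finset.sum_le_sum fun k _ => ?_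
    linarith [Real.arctan_lt_pi_div_two ((b - x k) / (κ ^ 2 * r)),
      Real.neg_pi_div_two_lt_arctan ((a - x k) / (κ ^ 2 * r))]
  have : (A - 2 * κ * B) * (b - a) = 2 * r * (1 - κ) * (A - 2 * κ * B) := by rw [ha, hb]; ring
  linarith

/-- Poisson sums that are nearly constant at two scales control the number of points. -/
lemma abs_count_sub_le (x : Fin n → ℝ) {c r κ A m : ℝ} (hr : 0 < r) (hκ : 0 < κ)
    (hκ1 : κ ≤ 1 / 2) (hA : 0 ≤ A) (hm : 0 ≤ m)
    (h : ∀ t, |t - c| ≤ 2 * r → |poissonSum x (κ ^ 2 * r) t - m| ≤ A)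
    (h' : ∀ t, |t - c| ≤ 2 * r → |poissonSum x (κ * r) t - m| ≤ A) :
    |(countIn n x (Set.Ioo (c - r) (c + r)) : ℝ) * Real.pi - 2 * r * m| ≤
      2 * r * A + 6 * κ * r * (m + A) := by
  have hu := count_le_of_poissonSum_le x (c := c) (B := m + A) hr hκ fun t ht => by
    linarith [(abs_le.1 (h t (ht.trans (by nlinarith)))).2]
  have hl := le_count_of_le_poissonSum x (c := c) (A := m - A) (B := m + A) hr hκ (by linarith)
    (fun t ht => by linarith [(abs_le.1 (h t (ht.trans (by linarith)))).1])
    (fun t ht => by linarith [(abs_le.1 (h' t (ht.trans (by linarith)))).2])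
  set N : ℝ := (countIn n x (Set.Ioo (c - r) (c + r)) : ℝ)
  have hN : 0 ≤ N := Nat.cast_nonneg _
  have hπ := Real.pi_gt_three
  have hP : 0 ≤ r * (m + A) := by positivity
  have hκP : 0 ≤ κ * (r * (m + A)) := by positivity
  have h1 : N * 2 ≤ 3 * (r * (m + A)) := by
    have e1 : N * 2 ≤ N * (Real.pi - 2 * κ) := by gcongr; linarith
    have e2 : κ * (r * (m + A)) ≤ 1 / 2 * (r * (m + A)) := by gcongr
    nlinarith
  have h2 : κ * (N * 2) ≤ κ * (3 * (r * (m + A))) := by gcongr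
  have h3 : 0 ≤ κ * (r * A) := by positivity
  have h4 : 0 ≤ κ * (κ * (r * (m + A))) := by positivity
  rw [abs_le]
  constructor
  · nlinarith
  · nlinarith

end Tauberian

section Bulk

lemma hull_remainder_le (C : ℝ) (n : ℕ) :
    9 * C + 17 + 2 * Real.log (1 + n * 16) + 4 * Real.sqrt n ≤ 9 * C + 21 + 20 * Real.sqrt n := by
  have h0 := Real.sqrt_nonneg (n : ℝ)
  have h1 : (n : ℝ) = Real.sqrt n * Real.sqrt n := (Real.mul_self_sqrt (Nat.cast_nonneg n)).symm
  have h2 : Real.log (1 + n * 16) ≤ 2 * Real.log (1 + 4 * Real.sqrt n) := by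
    rw [← Real.log_rpow (by positivity), Real.rpow_two]
    apply Real.log_le_log (by positivity)
    nlinarith
  have h3 := Real.log_le_sub_one_of_pos (show 0 < 1 + 4 * Real.sqrt (n : ℝ) by positivity)
  linarith

lemma eventually_const_add_sqrt_le (a b : ℝ) {ε : ℝ} (hε : 0 < ε) :
    ∀ᶠ n : ℕ in atTop, a + b * Real.sqrt n ≤ ε * n := by
  have h : Tendsto (fun n : ℕ => Real.sqrt (n : ℝ)) atTop atTop :=
    Real.tendsto_sqrt_atTop.comp tendsto_natCast_atTop_atTop
  filter_upwards [h.eventually_ge_atTop ((|a| + |b|) / ε), h.eventually_ge_atTop 1] with n h1 h2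
  have e : (n : ℝ) = Real.sqrt n * Real.sqrt n := (Real.mul_self_sqrt (Nat.cast_nonneg n)).symm
  rw [div_le_iff₀ hε] at h1
  generalize Real.sqrt (n : ℝ) = q at *
  have h3 := mul_le_mul_of_nonneg_right h1 (by linarith : 0 ≤ q)
  have h4 : |a| * 1 ≤ |a| * q := by gcongr
  have h5 : b * q ≤ |b| * q := by gcongr; exact le_abs_self b
  rw [e]
  nlinarith [le_abs_self a]

lemma eventually_hull (C : ℝ) {ε : ℝ} (hε : 0 < ε) :
    ∀ᶠ n : ℕ in atTop, ∀ x : Fin n → ℝ, GoodConfig C x → ∀ j : Fin n,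
      energyWeight x j ≤ ε * n ∧ (∃ k, x k ≤ -2 + ε) ∧ ∃ k, 2 - ε ≤ x k := by
  filter_upwards [eventually_const_add_sqrt_le (9 * C + 21) 20 hε,
    eventually_const_add_sqrt_le (10 * C + 21) 20 (show 0 < (ε / 6) ^ 2 by positivity),
    eventually_gt_atTop ⌈2 * C + 2⌉₊] with n h1 h2 h3 x hg j
  have hn := n_pos j
  have : Nonempty (Fin n) := ⟨j⟩
  obtain ⟨a, ha⟩ := Finite.exists_min x
  obtain ⟨b, hb⟩ := Finite.exists_max x
  have hh := hg.hull_bound j a b ha hb (Nat.lt_of_ceil_lt h3)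
  have hr := hull_remainder_le C n
  have hw := hg.weight j
  have p1 : 0 ≤ n * ((x a + x b) / 2) ^ 2 / 4 := by positivity
  have p2 : 0 ≤ n * ((x b - x a) / 4 - 1) ^ 2 / 2 := by positivity
  have q1 : |(x a + x b) / 4| ≤ ε / 6 := by
    apply abs_le_of_sq_le_sq _ (by positivity)
    have : n * ((x a + x b) / 4) ^ 2 ≤ n * (ε / 6) ^ 2 := by nlinarith
    exact le_of_mul_le_mul_left this hn
  have q2 : |((x b - x a) / 4 - 1) / 2| ≤ ε / 6 := by
    apply abs_le_of_sq_le_sq _ (by positivity)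
    have : n * (((x b - x a) / 4 - 1) / 2) ^ 2 ≤ n * (ε / 6) ^ 2 := by nlinarith
    exact le_of_mul_le_mul_left this hn
  rw [abs_le] at q1 q2
  exact ⟨by linarith, ⟨a, by linarith⟩, ⟨b, by linarith⟩⟩

lemma pi_mul_semicircle {x : ℝ} (hx : x ∈ Set.Ioo (-2 : ℝ) 2) :
    Real.pi * semicircle x = -(joukowskyInv x).im := by
  rw [joukowskyInv_real_im hx, semicircle, max_eq_left (by nlinarith [hx.1, hx.2])]
  have := Real.pi_pos
  field_simp

lemma semicircle_nonneg (x : ℝ) : 0 ≤ semicircle x := by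
  have := Real.pi_pos
  rw [semicircle]; positivity

lemma pi_mul_semicircle_le_one (x : ℝ) : Real.pi * semicircle x ≤ 1 := by
  have := Real.pi_pos
  have h : Real.sqrt (max (4 - x ^ 2) 0) ≤ 2 := by
    rw [Real.sqrt_le_left (by norm_num)]
    apply max_le <;> nlinarith [sq_nonneg x]
  rw [semicircle]
  field_simp
  linarith

lemma log_remainder_le {C κ Q u y n : ℝ} (hκ : 0 < κ) (hC : 0 ≤ C)
    (hQ : 40 * C + 141 ≤ Q * κ ^ 3) (hQ3 : 141 ≤ Q) (hy0 : 0 < y) (hyn : κ ^ 2 * Q ^ 2 ≤ y * n)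
    (hu : 0 ≤ u) (hu' : u ≤ 4 * Q ^ 4) :
    (4 * (10 * C + 19 + 2 * Real.log (1 + u)) + 1) / y ≤ n * κ := by
  have h3 : Real.log (1 + u) ≤ 4 * Real.log (2 * Q) := by
    rw [show 4 * Real.log (2 * Q) = ((4 : ℕ) : ℝ) * Real.log (2 * Q) by norm_num, ← Real.log_pow]
    apply Real.log_le_log (by positivity)
    have : (1 : ℝ) ≤ Q ^ 4 := one_le_pow₀ (by linarith)
    have e : (2 * Q) ^ 4 = 16 * Q ^ 4 := by ring
    rw [e]
    linarith
  have h4 := Real.log_le_sub_one_of_pos (show 0 < 2 * Q by positivity)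
  rw [div_le_iff₀ hy0]
  have h5 : κ * (κ ^ 2 * Q ^ 2) ≤ κ * (y * n) := by gcongr
  have h6 := mul_le_mul_of_nonneg_right hQ (by linarith : 0 ≤ Q)
  have h7 : C * 1 ≤ C * Q := by gcongr; linarith
  have h8 : κ * (κ ^ 2 * Q ^ 2) = Q * κ ^ 3 * Q := by ring
  linarith

lemma sqrt_scale_bounds {C κ g : ℝ} (hC : 0 ≤ C) (hκ : 0 < κ) (hκ1 : κ ≤ 1 / 2)
    (hg : (40 * C + 141) ^ 2 / κ ^ 6 ≤ g) :
    40 * C + 141 ≤ Real.sqrt g * κ ^ 3 ∧ 141 ≤ Real.sqrt g ∧ 1 < Real.sqrt g * κ ∧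
      g = Real.sqrt g ^ 2 := by
  have hg0 : 0 ≤ g := le_trans (by positivity) hg
  rw [show (40 * C + 141) ^ 2 / κ ^ 6 = ((40 * C + 141) / κ ^ 3) ^ 2 by
    rw [div_pow, ← pow_mul]] at hg
  have hQ2 := Real.le_sqrt_of_sq_le hg
  rw [div_le_iff₀ (by positivity)] at hQ2
  have hQ0 := Real.sqrt_nonneg g
  have e := (Real.sq_sqrt hg0).symm
  generalize Real.sqrt g = Q at *
  have h1 : κ ^ 3 ≤ κ := pow_le_of_le_one hκ.le (by linarith) (by norm_num)
  have h2 : Q * κ ^ 3 ≤ Q * κ := by gcongr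
  have h3 : Q * κ ≤ Q * 1 := by gcongr; linarith
  exact ⟨hQ2, by linarith, by linarith, e⟩

lemma exists_poissonSum_close {C κ : ℝ} (hC : 0 ≤ C) (hκ : 0 < κ) (hκ1 : κ ≤ 1 / 2) {x₀ : ℝ}
    (hx₀ : x₀ ∈ Set.Ioo (-2 : ℝ) 2) :
    ∃ δ > (0 : ℝ), ∀ᶠ n : ℕ in atTop, ∀ x : Fin n → ℝ, GoodConfig C x →
      ∀ g : ℝ, (40 * C + 141) ^ 2 / κ ^ 6 ≤ g → g ≤ δ * n → ∀ j, n * |x₀ - x j| ≤ g ^ 2 →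
        ∀ t y, |t - x₀| ≤ 2 * (g / n) → κ ^ 2 * (g / n) ≤ y → y ≤ g / n →
          |poissonSum x y t - n * (Real.pi * semicircle x₀)| ≤ 3 * n * κ := by
  have hx₀' : |x₀| < 2 := abs_lt.2 hx₀
  set δ₁ := (2 - |x₀|) / 2 with hδ₁
  have hδ₁0 : 0 < δ₁ := by linarith
  have hδ₁1 : δ₁ ≤ 1 := by linarith [abs_nonneg x₀]
  obtain ⟨δ₂, hδ₂, hcont⟩ := Metric.continuousAt_iff.1 (continuousAt_joukowskyInv_real hx₀) κ hκ
  set s := κ * δ₁ ^ 2 / 384 with hs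
  have hs0 : 0 < s := by positivity
  have hs1 : s ≤ 1 / 4 := by
    have : δ₁ ^ 2 ≤ 1 := by nlinarith
    rw [hs]; nlinarith
  refine ⟨min δ₁ δ₂ / 6, by positivity, ?_⟩
  filter_upwards [eventually_hull C hδ₁0, eventually_hull C (show 0 < s ^ 2 / 2 by positivity),
    eventually_const_add_sqrt_le (C - Real.log s) 0 (show 0 < s ^ 2 / 2 by positivity)]
    with n hn1 hn2 hn3 x hg g hg1 hg2 j hj t y ht hy hy'
  have hn := n_pos j
  obtain ⟨hQ2, hQ3, hQκ, hgQ⟩ := sqrt_scale_bounds hC hκ hκ1 hg1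
  set Q := Real.sqrt g with hQ
  clear_value Q
  have hg141 : 1 ≤ g := by rw [hgQ]; nlinarith only [hQ3]
  have hyn : κ ^ 2 * g ≤ y * n := by
    have := mul_le_mul_of_nonneg_right hy hn.le
    rwa [mul_assoc, div_mul_cancel₀ _ hn.ne'] at this
  have hyn' : y * n ≤ g := by rwa [le_div_iff₀ hn] at hy'
  have hy1 : 1 / n < y := by
    rw [div_lt_iff₀ hn]
    refine lt_of_lt_of_le ?_ hyn
    rw [hgQ, ← mul_pow]
    nlinarith only [hQκ]
  have hy0 : 0 < y := lt_trans (by positivity) hy1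
  have hgn : g / n ≤ min δ₁ δ₂ / 6 := by rwa [div_le_iff₀ hn]
  have hm1 := min_le_left δ₁ δ₂
  have hm2 := min_le_right δ₁ δ₂
  have hlog : C + energyWeight x j - Real.log s ≤ n * s ^ 2 := by
    have := (hn2 x hg j).1
    linarith
  obtain ⟨_, ⟨k₁, hk₁⟩, k₂, hk₂⟩ := hn1 x hg j
  have hax := neg_abs_le x₀
  have hax' := le_abs_self x₀
  have key := hg.poissonSum_close j (x₀ := x₀) (δ := δ₁) (M := 24 * n * s) hx₀'.le hδ₁0 hδ₁1
    ⟨k₁, by linarith⟩ ⟨k₂, by linarith⟩ (by positivity)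
    (fun z h1 h2 h3 => hg.harnack_bulk j hs0 hs1 hlog h1 h2 h3) hy1 (t := t) (by linarith)
  have e1 : 16 * (24 * n * s) / δ₁ ^ 2 = n * κ := by rw [hs]; field_simp; ring
  have e2 : (4 * (10 * C + 19 + 2 * Real.log (1 + n * (|t - x j| + y))) + 1) / y ≤ n * κ := by
    have h1 : |t - x j| ≤ |t - x₀| + |x₀ - x j| := abs_sub_le _ _ _
    have h2 : n * (|t - x j| + y) ≤ 4 * g ^ 2 := by
      have h3 : n * |t - x₀| ≤ 2 * g := by
        have := mul_le_mul_of_nonneg_left ht hn.le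
        rwa [mul_left_comm, mul_div_cancel₀ _ hn.ne'] at this
      have h4 : n * |t - x j| ≤ n * (|t - x₀| + |x₀ - x j|) := by gcongr
      have h5 : g ≤ g ^ 2 := by nlinarith only [hg141]
      linarith
    refine log_remainder_le hκ hC hQ2 hQ3 hy0 (by rwa [← hgQ]) (by positivity) (h2.trans_eq ?_)
    rw [hgQ]; ring
  have e3 : |n * (joukowskyInv ⟨t, y⟩).im + n * (Real.pi * semicircle x₀)| ≤ n * κ := by
    have h1 : ‖(⟨t, y⟩ : ℂ) - x₀‖ < δ₂ := by
      refine (norm_mk_sub_le t x₀ hy0.le).trans_lt ?_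
      linarith
    have h2 := hcont (x := ⟨t, y⟩) (by rwa [dist_eq_norm])
    rw [dist_eq_norm] at h2
    have h3 := (Complex.abs_im_le_norm _).trans h2.le
    rw [pi_mul_semicircle hx₀, ← mul_add, abs_mul, abs_of_pos hn, ← sub_eq_add_neg,
      ← Complex.sub_im]
    gcongr
  have e4 := abs_sub (poissonSum x y t + n * (joukowskyInv ⟨t, y⟩).im)
    (n * (joukowskyInv ⟨t, y⟩).im + n * (Real.pi * semicircle x₀))
  rw [show poissonSum x y t + n * (joukowskyInv ⟨t, y⟩).im -
    (n * (joukowskyInv ⟨t, y⟩).im + n * (Real.pi * semicircle x₀)) =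
      poissonSum x y t - n * (Real.pi * semicircle x₀) by ring] at e4
  linarith

/-- Counting statistics of good configurations at all scales between a constant and `δ n`
microscopic units. -/
lemma exists_count_close {C ε : ℝ} (hC : 0 ≤ C) (hε : 0 < ε) :
    ∃ L₀ ≥ (1 : ℝ), ∀ x₀ ∈ Set.Ioo (-2 : ℝ) 2, ∃ δ > (0 : ℝ), ∀ᶠ n : ℕ in atTop, ∀ x : Fin n → ℝ,
      GoodConfig C x → ∀ g : ℝ, L₀ ≤ g → g ≤ δ * n → ∀ j, n * |x₀ - x j| ≤ g ^ 2 →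
        |(countIn n x (Set.Ioo (x₀ - g / n) (x₀ + g / n)) : ℝ) - 2 * g * semicircle x₀| ≤
          ε * g := by
  obtain ⟨κ, hκ, hκ1, hκε⟩ : ∃ κ : ℝ, 0 < κ ∧ κ ≤ 1 / 2 ∧ 7 * κ ≤ ε :=
    ⟨min (1 / 2) (ε / 7), by positivity, min_le_left _ _, by
      linarith [min_le_right (1 / 2) (ε / 7)]⟩
  refine ⟨(40 * C + 141) ^ 2 / κ ^ 6, ?_, fun x₀ hx₀ => ?_⟩
  · rw [ge_iff_le, one_le_div (by positivity)]
    have : κ ^ 6 ≤ 1 := pow_le_one₀ hκ.le (by linarith)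
    nlinarith
  obtain ⟨δ, hδ, hclose⟩ := exists_poissonSum_close hC hκ hκ1 hx₀
  refine ⟨δ, hδ, ?_⟩
  filter_upwards [hclose] with n hn x hg g hg1 hg2 j hj
  have hn0 := n_pos j
  have hg0 : 0 < g := lt_of_lt_of_le (by positivity) hg1
  have hr : 0 < g / n := by positivity
  have hπ := Real.pi_gt_three
  have hσ := semicircle_nonneg x₀
  have hσ1 := pi_mul_semicircle_le_one x₀
  have hκ2 : κ ^ 2 ≤ κ := by nlinarith
  have h := abs_count_sub_le x (c := x₀) (A := 3 * n * κ) (m := n * (Real.pi * semicircle x₀)) hr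
    hκ hκ1 (by positivity) (by positivity)
    (fun t ht => hn x hg g hg1 hg2 j hj t _ ht le_rfl (by nlinarith))
    (fun t ht => hn x hg g hg1 hg2 j hj t _ ht (by gcongr) (by nlinarith))
  set N : ℝ := (countIn n x (Set.Ioo (x₀ - g / n) (x₀ + g / n)) : ℝ)
  have e1 : N * Real.pi - 2 * (g / n) * (n * (Real.pi * semicircle x₀)) =
      Real.pi * (N - 2 * g * semicircle x₀) := by field_simp
  have e2 : 2 * (g / n) * (3 * n * κ) + 6 * κ * (g / n) * (n * (Real.pi * semicircle x₀) +
      3 * n * κ) = 6 * (κ * g) + 6 * (κ * g) * (Real.pi * semicircle x₀ + 3 * κ) := by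
    field_simp
    ring
  have hκg : 0 < κ * g := by positivity
  have e3 : (κ * g) * (Real.pi * semicircle x₀ + 3 * κ) ≤ (κ * g) * (5 / 2) := by
    gcongr; linarith
  rw [e1, e2, abs_mul, abs_of_pos Real.pi_pos] at h
  have h2 : 3 * |N - 2 * g * semicircle x₀| ≤ 21 * (κ * g) := by
    have : 3 * |N - 2 * g * semicircle x₀| ≤ Real.pi * |N - 2 * g * semicircle x₀| := by gcongr
    linarith
  have h3 : 7 * κ * g ≤ ε * g := by gcongr
  linarith

lemma countIn_eq_zero {n : ℕ} {x : Fin n → ℝ} {c r : ℝ} (h : ∀ k, r ≤ |c - x k|) :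
    countIn n x (Set.Ioo (c - r) (c + r)) = 0 := by
  rw [countIn_Ioo_eq, Finset.card_eq_zero, Finset.filter_eq_empty_iff]
  intro k _
  rw [abs_sub_comm]
  exact not_lt.2 (h k)

/-- The semicircle law at microscopic scales for good configurations. -/
theorem eventually_count_close {C : ℝ} {x : (n : ℕ) → Fin n → ℝ}
    (hg : ∀ᶠ n in atTop, GoodConfig C (x n)) {ε : ℝ} (hε : 0 < ε) :
    ∃ L₀ > (0 : ℝ), ∀ L ≥ L₀, ∀ x₀ ∈ Set.Ioo (-2 : ℝ) 2, ∀ᶠ n : ℕ in atTop,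
      |(countIn n (x n) (Set.Ioo (x₀ - L / n) (x₀ + L / n)) : ℝ) / (2 * L) - semicircle x₀| ≤
        ε := by
  have hC : 0 ≤ C := hg.exists.choose_spec.nonneg
  obtain ⟨L₀, hL₀, hM⟩ := exists_count_close hC hε
  refine ⟨L₀, by linarith, fun L hL x₀ hx₀ => ?_⟩
  obtain ⟨δ, hδ, hev⟩ := hM x₀ hx₀
  have hL0 : 0 < L := by linarith
  have hσ := semicircle_nonneg x₀
  have htop : Tendsto (fun n : ℕ => δ * (n : ℝ)) atTop atTop :=
    tendsto_natCast_atTop_atTop.const_mul_atTop hδ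
  filter_upwards [hg, hev, htop.eventually_ge_atTop L, htop.eventually_ge_atTop (10 / δ),
    eventually_gt_atTop 0] with n hgn hn hn1 hn2 hn0
  have hn0' : (0 : ℝ) < n := by exact_mod_cast hn0
  have : Nonempty (Fin n) := ⟨⟨0, hn0⟩⟩
  obtain ⟨j, hj⟩ := Finite.exists_min fun k => |x₀ - x n k|
  by_cases hd : n * |x₀ - x n j| ≤ L
  · have h := hn (x n) hgn L hL hn1 j (by nlinarith)
    set N : ℝ := (countIn n (x n) (Set.Ioo (x₀ - L / n) (x₀ + L / n)) : ℝ)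
    have e : N / (2 * L) - semicircle x₀ = (N - 2 * L * semicircle x₀) / (2 * L) := by field_simp
    rw [e, abs_div, abs_of_pos (by positivity : 0 < 2 * L), div_le_iff₀ (by positivity)]
    nlinarith
  · push Not at hd
    have hLn : ∀ k, L / n ≤ |x₀ - x n k| := fun k => by
      rw [div_le_iff₀ hn0']; linarith [mul_le_mul_of_nonneg_left (hj k) hn0'.le]
    rw [countIn_eq_zero hLn]
    obtain ⟨g, hgL, hgδ, hgd, hgd'⟩ : ∃ g, L ≤ g ∧ g ≤ δ * n ∧ g ≤ n * |x₀ - x n j| ∧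
        n * |x₀ - x n j| ≤ g ^ 2 := by
      rcases le_total (n * |x₀ - x n j|) (δ * n) with h | h
      · exact ⟨_, hd.le, h, le_rfl, by nlinarith⟩
      · refine ⟨δ * n, hn1, le_rfl, h, ?_⟩
        have h1 : |x₀ - x n j| ≤ 10 := by
          have := abs_sub x₀ (x n j)
          linarith [hgn.bdd j, abs_lt.2 hx₀]
        have h2 : 10 ≤ δ * n * δ := by rwa [div_le_iff₀ hδ] at hn2
        calc n * |x₀ - x n j| ≤ n * (δ * n * δ) := by gcongr; linarith
          _ = _ := by ring
    have h := hn (x n) hgn g (hL.trans hgL) hgδ j hgd'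
    have hgn' : ∀ k, g / n ≤ |x₀ - x n k| := fun k => by
      rw [div_le_iff₀ hn0']; linarith [mul_le_mul_of_nonneg_left (hj k) hn0'.le]
    rw [countIn_eq_zero hgn'] at h
    have hg0 : 0 < g := by linarith
    simp only [Nat.cast_zero, zero_sub, abs_neg, zero_div] at h ⊢
    rw [abs_of_nonneg (by positivity)] at h
    rw [abs_of_nonneg hσ]
    nlinarith

lemma abs_limsup_sub_le {f : ℕ → ℝ} {a ε : ℝ} (h : ∀ᶠ n in atTop, |f n - a| ≤ ε) :
    |limsup f atTop - a| ≤ ε ∧ |liminf f atTop - a| ≤ ε := by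
  have hu : ∀ᶠ n in atTop, f n ≤ a + ε := h.mono fun n hn => by linarith [(abs_le.1 hn).2]
  have hl : ∀ᶠ n in atTop, a - ε ≤ f n := h.mono fun n hn => by linarith [(abs_le.1 hn).1]
  have bu : IsBoundedUnder (· ≤ ·) atTop f := ⟨_, hu⟩
  have bl : IsBoundedUnder (· ≥ ·) atTop f := ⟨_, hl⟩
  have h1 := limsup_le_of_le bl.isCoboundedUnder_le hu
  have h2 := le_liminf_of_le bu.isCoboundedUnder_ge hl
  have h3 := liminf_le_limsup bu bl
  constructor <;> rw [abs_le] <;> constructor <;> linarith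

/-- Beurling-Landau densities of good configurations. -/
theorem density_of_goodConfig {C : ℝ} {x : (n : ℕ) → Fin n → ℝ}
    (hg : ∀ᶠ n in atTop, GoodConfig C (x n)) :
    TendstoUniformlyOn
        (fun (L : ℝ) (x₀ : ℝ) => Filter.limsup
          (fun n : ℕ => (countIn n (x n) (Set.Ioo (x₀ - L / n) (x₀ + L / n)) : ℝ) / (2 * L)) atTop)
        semicircle atTop (Set.Ioo (-2 : ℝ) 2) ∧
      TendstoUniformlyOn
        (fun (L : ℝ) (x₀ : ℝ) => Filter.liminf
          (fun n : ℕ => (countIn n (x n) (Set.Ioo (x₀ - L / n) (x₀ + L / n)) : ℝ) / (2 * L)) atTop)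
        semicircle atTop (Set.Ioo (-2 : ℝ) 2) := by
  rw [Metric.tendstoUniformlyOn_iff, Metric.tendstoUniformlyOn_iff]
  constructor <;> intro ε hε <;>
    obtain ⟨L₀, -, h⟩ := eventually_count_close hg (half_pos hε) <;>
    filter_upwards [eventually_ge_atTop L₀] with L hL x₀ hx₀ <;>
    rw [dist_comm, Real.dist_eq]
  · exact (abs_limsup_sub_le (h L hL x₀ hx₀)).1.trans_lt (half_lt_self hε)
  · exact (abs_limsup_sub_le (h L hL x₀ hx₀)).2.trans_lt (half_lt_self hε)

end Bulk

section Cauchy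

variable {n : ℕ}

/-- The unnormalized one-point weight of a position `t` in the field of the points other than
`x j`. -/
noncomputable def pointWeight (x : Fin n → ℝ) (j : Fin n) (t : ℝ) : ℝ :=
  (∏ k ∈ Finset.univ.erase j, |t - x k|) * Real.exp (-(n * (t ^ 2 / 4 - 1 / 2)))

/-- The outer function whose modulus on the unit circle is the one-point weight. -/
noncomputable def outerWeight (x : Fin n → ℝ) (j : Fin n) (ζ : ℂ) : ℂ :=
  (∏ k ∈ Finset.univ.erase j, (1 - x k * ζ + ζ ^ 2)) * Complex.exp (-(n * ζ ^ 2 / 2))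

lemma pointWeight_nonneg (x : Fin n → ℝ) (j : Fin n) (t : ℝ) : 0 ≤ pointWeight x j t := by
  rw [pointWeight]
  exact mul_nonneg (Finset.prod_nonneg fun _ _ => abs_nonneg _) (Real.exp_pos _).le

lemma continuous_pointWeight (x : Fin n → ℝ) (j : Fin n) : Continuous (pointWeight x j) := by
  unfold pointWeight; fun_prop

lemma differentiable_outerWeight (x : Fin n → ℝ) (j : Fin n) :
    Differentiable ℂ (outerWeight x j) := by
  unfold outerWeight; fun_prop

lemma outerWeight_zero (x : Fin n → ℝ) (j : Fin n) : outerWeight x j 0 = 1 := by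
  simp [outerWeight]

lemma pointWeight_self {x : Fin n → ℝ} (hx : Function.Injective x) (j : Fin n) :
    pointWeight x j (x j) = Real.exp (energyWeight x j) := by
  rw [pointWeight, energyWeight, sub_eq_add_neg (∑ k ∈ _, _), Real.exp_add, Real.exp_sum]
  congr 1
  refine Finset.prod_congr rfl fun k hk => (Real.exp_log ?_).symm
  rw [abs_pos, sub_ne_zero]
  exact fun e => Finset.ne_of_mem_erase hk (hx e).symm

lemma circleMap_add_inv (θ : ℝ) :
    circleMap 0 1 θ + (circleMap 0 1 θ)⁻¹ = ((2 * Real.cos θ : ℝ) : ℂ) := by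
  simp [circleMap, Complex.two_cos, ← Complex.exp_neg]

lemma norm_one_sub_circleMap_sq (θ : ℝ) : ‖1 - circleMap 0 1 θ ^ 2‖ = |2 * Real.sin θ| := by
  have h : (1 - circleMap 0 1 θ ^ 2) * Complex.I =
      circleMap 0 1 θ * ((2 * Real.sin θ : ℝ) : ℂ) := by
    push_cast
    rw [Complex.two_sin]
    simp only [circleMap, Complex.ofReal_one, one_mul, zero_add, mul_sub, sub_mul, ← mul_assoc,
      ← Complex.exp_add, pow_two]
    simp
  have := congrArg norm h
  simpa [norm_mul, -Complex.ofReal_sin, -Complex.ofReal_mul, abs_mul] using this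

lemma neg_natCast_mul_div_two_re (n : ℕ) (w : ℂ) :
    (-(n * w / 2)).re = -(n * (w.re / 2)) := by
  simp [mul_div_assoc]

lemma norm_outerWeight_circleMap (x : Fin n → ℝ) (j : Fin n) (θ : ℝ) :
    ‖outerWeight x j (circleMap 0 1 θ)‖ = pointWeight x j (2 * Real.cos θ) := by
  have h1 : ‖circleMap 0 1 θ‖ = 1 := by simp
  have h0 : circleMap 0 1 θ ≠ 0 := by rw [← norm_ne_zero_iff, h1]; norm_num
  rw [outerWeight, pointWeight, norm_mul, norm_prod, Complex.norm_exp]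
  congr 1
  · refine Finset.prod_congr rfl fun k _ => ?_
    have : 1 - x k * circleMap 0 1 θ + circleMap 0 1 θ ^ 2 =
        circleMap 0 1 θ * ((2 * Real.cos θ - x k : ℝ) : ℂ) := by
      rw [Complex.ofReal_sub, ← circleMap_add_inv]
      field_simp
      ring
    rw [this, norm_mul, h1, one_mul, Complex.norm_real, Real.norm_eq_abs]
  · have : (circleMap 0 1 θ ^ 2).re = 2 * Real.cos θ ^ 2 - 1 := by
      rw [← Real.cos_two_mul]
      simp only [circleMap, Complex.ofReal_one, one_mul, zero_add, pow_two, ← Complex.exp_add]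
      rw [← two_mul, ← mul_assoc, show (2 * (θ : ℂ)) = ((2 * θ : ℝ) : ℂ) by push_cast; ring,
        Complex.exp_ofReal_mul_I_re]
    rw [neg_natCast_mul_div_two_re, this]
    ring_nf

/-- Integration over the circle of functions of the abscissa. -/
lemma integral_comp_two_mul_cos {φ : ℝ → ℝ} (hφ : Continuous φ) :
    ∫ θ in 0..2 * Real.pi, φ (2 * Real.cos θ) * |2 * Real.sin θ| = 2 * ∫ t in -2..2, φ t := by
  have hd : ∀ θ : ℝ, HasDerivAt (fun θ => 2 * Real.cos θ) (2 * -Real.sin θ) θ :=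
    fun θ => (Real.hasDerivAt_cos θ).const_mul 2
  have hc : Continuous fun θ : ℝ => φ (2 * Real.cos θ) * |2 * Real.sin θ| := by fun_prop
  have hsub : ∀ a b : ℝ, ∫ θ in a..b, φ (2 * Real.cos θ) * (2 * -Real.sin θ) =
      ∫ t in (2 * Real.cos a)..(2 * Real.cos b), φ t := fun a b =>
    intervalIntegral.integral_comp_mul_deriv (fun θ _ => hd θ) (by fun_prop) hφ
  have hπ := Real.pi_pos
  rw [← intervalIntegral.integral_add_adjacent_intervals (hc.intervalIntegrable 0 Real.pi)
    (hc.intervalIntegrable Real.pi (2 * Real.pi))]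
  have h1 : ∫ θ in (0)..Real.pi, φ (2 * Real.cos θ) * |2 * Real.sin θ| = ∫ t in -2..2, φ t := by
    have e : ∀ θ ∈ Set.uIcc 0 Real.pi, φ (2 * Real.cos θ) * |2 * Real.sin θ| =
        -(φ (2 * Real.cos θ) * (2 * -Real.sin θ)) := by
      intro θ hθ
      rw [Set.uIcc_of_le hπ.le] at hθ
      have := Real.sin_nonneg_of_nonneg_of_le_pi hθ.1 hθ.2
      rw [abs_of_nonneg (by positivity)]; ring
    rw [intervalIntegral.integral_congr e, intervalIntegral.integral_neg, hsub,
      ← intervalIntegral.integral_symm]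
    simp
  have h2 : ∫ θ in Real.pi..2 * Real.pi, φ (2 * Real.cos θ) * |2 * Real.sin θ| =
      ∫ t in -2..2, φ t := by
    have e : ∀ θ ∈ Set.uIcc Real.pi (2 * Real.pi), φ (2 * Real.cos θ) * |2 * Real.sin θ| =
        φ (2 * Real.cos θ) * (2 * -Real.sin θ) := by
      intro θ hθ
      rw [Set.uIcc_of_le (by linarith)] at hθ
      have := Real.sin_nonneg_of_nonneg_of_le_pi (x := θ - Real.pi) (by linarith [hθ.1])
        (by linarith [hθ.2])
      rw [Real.sin_sub_pi] at this
      rw [abs_of_nonpos (by linarith)]; ring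
    rw [intervalIntegral.integral_congr e, hsub]
    simp
  rw [h1, h2]; ring

lemma norm_le_integral_circle {f : ℂ → ℂ} (hf : Differentiable ℂ f) {w : ℂ} (hw : ‖w‖ < 1) :
    2 * Real.pi * (1 - ‖w‖) * ‖f w‖ ≤ ∫ θ in 0..2 * Real.pi, ‖f (circleMap 0 1 θ)‖ := by
  have hw' : w ∈ Metric.ball (0 : ℂ) 1 := by simpa using hw
  have h := (hf.diffContOnCl (s := Metric.ball 0 1)).two_pi_i_inv_smul_circleIntegral_sub_inv_smul
    hw'
  have h2 : ‖∮ z in C(0, 1), (z - w)⁻¹ • f z‖ ≤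
      ∫ θ in 0..2 * Real.pi, (1 - ‖w‖)⁻¹ * ‖f (circleMap 0 1 θ)‖ := by
    rw [circleIntegral]
    have hcf : Continuous fun θ : ℝ => (1 - ‖w‖)⁻¹ * ‖f (circleMap 0 1 θ)‖ :=
      continuous_const.mul (hf.continuous.comp (continuous_circleMap 0 1)).norm
    refine intervalIntegral.norm_integral_le_of_norm_le Real.two_pi_pos.le ?_
      (hcf.intervalIntegrable _ _)
    refine Filter.Eventually.of_forall fun θ _ => ?_
    rw [norm_smul, norm_smul, norm_inv]
    have h3 : ‖deriv (circleMap 0 1) θ‖ = 1 := by simp [deriv_circleMap]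
    rw [h3, one_mul]
    have h4 : 1 - ‖w‖ ≤ ‖circleMap 0 1 θ - w‖ := by
      have := norm_sub_norm_le (circleMap 0 1 θ) w
      simpa using this
    have : 0 < 1 - ‖w‖ := by linarith
    gcongr
  rw [intervalIntegral.integral_const_mul] at h2
  have h3 := congrArg norm h
  rw [norm_smul] at h3
  have h5 : ‖(2 * Real.pi * Complex.I : ℂ)⁻¹‖ = (2 * Real.pi)⁻¹ := by
    simp [abs_of_pos Real.pi_pos]
  rw [h5] at h3
  have hπ := Real.pi_pos
  have h6 : 0 < 1 - ‖w‖ := by linarith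
  rw [← h3]
  calc 2 * Real.pi * (1 - ‖w‖) * ((2 * Real.pi)⁻¹ * ‖∮ z in C(0, 1), (z - w)⁻¹ • f z‖)
      = (1 - ‖w‖) * ‖∮ z in C(0, 1), (z - w)⁻¹ • f z‖ := by field_simp
    _ ≤ (1 - ‖w‖) * ((1 - ‖w‖)⁻¹ * ∫ θ in 0..2 * Real.pi, ‖f (circleMap 0 1 θ)‖) := by gcongr
    _ = _ := by field_simp

lemma norm_outerWeight_pow_le (x : Fin n → ℝ) (j : Fin n) (m : ℕ) {ζ : ℂ} (hζ : ‖ζ‖ < 1) :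
    ‖outerWeight x j ζ‖ ^ m * (1 - ‖ζ‖) ^ 2 ≤ ∫ t in -2..2, pointWeight x j t ^ m := by
  have hd : Differentiable ℂ fun z => outerWeight x j z ^ m * (1 - z ^ 2) :=
    ((differentiable_outerWeight x j).pow m).mul (by fun_prop)
  have h := norm_le_integral_circle hd hζ
  simp only [norm_mul, norm_pow, norm_outerWeight_circleMap] at h
  rw [intervalIntegral.integral_congr (g := fun θ =>
    (fun t => pointWeight x j t ^ m) (2 * Real.cos θ) * |2 * Real.sin θ|)
    (fun θ _ => by simp only [norm_one_sub_circleMap_sq]),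
    integral_comp_two_mul_cos (φ := fun t => pointWeight x j t ^ m)
      ((continuous_pointWeight x j).pow m)] at h
  have h1 : 1 - ‖ζ‖ ≤ ‖1 - ζ ^ 2‖ := by
    have := norm_sub_norm_le 1 (ζ ^ 2)
    rw [norm_one, norm_pow] at this
    nlinarith [norm_nonneg ζ]
  have h2 : 0 < 1 - ‖ζ‖ := by linarith
  have h3 : ‖outerWeight x j ζ‖ ^ m * (1 - ‖ζ‖) ^ 2 ≤
      (1 - ‖ζ‖) * (‖outerWeight x j ζ‖ ^ m * ‖1 - ζ ^ 2‖) := by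
    rw [pow_two, mul_left_comm]
    gcongr
  have h4 := Real.pi_gt_three
  have h5 : 0 ≤ (1 - ‖ζ‖) * (‖outerWeight x j ζ‖ ^ m * ‖1 - ζ ^ 2‖) := by positivity
  nlinarith

lemma one_sub_mul_joukowskyInv {z : ℂ} (hz : 0 < z.im) (c : ℝ) :
    1 - c * joukowskyInv z + joukowskyInv z ^ 2 = joukowskyInv z * (z - c) := by
  have hζ := joukowskyInv_ne_zero hz
  have : joukowskyInv z * z = joukowskyInv z ^ 2 + 1 := by
    rw [← congrArg (joukowskyInv z * ·) (joukowskyInv_add_inv hz)]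
    field_simp
  linear_combination -this

lemma outerWeight_joukowskyInv_ne_zero (x : Fin n → ℝ) (j : Fin n) {z : ℂ} (hz : 0 < z.im) :
    outerWeight x j (joukowskyInv z) ≠ 0 := by
  rw [outerWeight]
  refine mul_ne_zero (Finset.prod_ne_zero_iff.2 fun k _ => ?_) (Complex.exp_ne_zero _)
  rw [one_sub_mul_joukowskyInv hz]
  exact mul_ne_zero (joukowskyInv_ne_zero hz)
    (Complex.slitPlane_ne_zero (sub_ofReal_mem_slitPlane hz _))

lemma energyField_eq_log_outerWeight (x : Fin n → ℝ) (j : Fin n) {z : ℂ} (hz : 0 < z.im) :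
    energyField x j z =
      Real.log ‖joukowskyInv z‖ + Real.log ‖outerWeight x j (joukowskyInv z)‖ := by
  have hζ := joukowskyInv_ne_zero hz
  have hz' : ∀ k, ‖z - x k‖ ≠ 0 := fun k => by
    rw [norm_ne_zero_iff]
    exact Complex.slitPlane_ne_zero (sub_ofReal_mem_slitPlane hz _)
  have hne : ∀ k ∈ Finset.univ.erase j, ‖joukowskyInv z * (z - x k)‖ ≠ 0 := fun k _ => by
    rw [norm_mul]; exact mul_ne_zero (norm_ne_zero_iff.2 hζ) (hz' k)
  rw [energyField, potential_eq, outerWeight]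
  simp only [one_sub_mul_joukowskyInv hz]
  rw [norm_mul, norm_prod, Complex.norm_exp,
    Real.log_mul (Finset.prod_ne_zero_iff.2 hne) (Real.exp_pos _).ne', Real.log_exp,
    Real.log_prod hne]
  simp only [norm_mul]
  rw [Finset.sum_congr rfl fun k _ => Real.log_mul (norm_ne_zero_iff.2 hζ) (hz' k),
    Finset.sum_add_distrib, Finset.sum_const, Finset.card_erase_of_mem (Finset.mem_univ j),
    Finset.card_univ, Fintype.card_fin, nsmul_eq_mul, Nat.cast_sub j.pos, Nat.cast_one,
    neg_natCast_mul_div_two_re]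
  ring

lemma log_outerWeight_le {x : Fin n → ℝ} (hx : Function.Injective x) {c₀ : ℝ} (hc₀ : 0 < c₀)
    (hn : 18 ≤ n) {m : ℕ} (hm : c₀ / 2 * Real.log n ≤ m) {j : Fin n}
    (hI : ∫ t in -2..2, pointWeight x j t ^ m ≤
      (4 + (n : ℝ) ^ 4 * (1 + x j ^ 2)) * pointWeight x j (x j) ^ m)
    {ζ : ℂ} (hζ : 1 / (8 * n : ℝ) ≤ 1 - ‖ζ‖) (h0 : outerWeight x j ζ ≠ 0) :
    Real.log ‖outerWeight x j ζ‖ - energyWeight x j ≤ (16 + 4 * |x j|) / c₀ := by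
  have hn' : (18 : ℝ) ≤ n := by exact_mod_cast hn
  have hn0 : (0 : ℝ) < n := by linarith
  have h8 : 0 < 1 / (8 * n : ℝ) := by positivity
  have hlog : 1 ≤ Real.log n := by
    rw [Real.le_log_iff_exp_le hn0]
    linarith [Real.exp_one_lt_d9]
  have hO : 0 < ‖outerWeight x j ζ‖ := norm_pos_iff.2 h0
  have h := (norm_outerWeight_pow_le x j m (ζ := ζ) (by linarith)).trans hI
  rw [pointWeight_self hx] at h
  set B := 1 + x j ^ 2 with hB
  have hB1 : 1 ≤ B := by nlinarith [sq_nonneg (x j)]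
  have h1 : ‖outerWeight x j ζ‖ ^ m * (1 / (8 * n : ℝ)) ^ 2 ≤
      5 * (n : ℝ) ^ 4 * B * Real.exp (energyWeight x j) ^ m := by
    have h2 : (4 + (n : ℝ) ^ 4 * B) ≤ 5 * (n : ℝ) ^ 4 * B := by
      have h3 : (1 : ℝ) ≤ (n : ℝ) ^ 4 := one_le_pow₀ (by linarith)
      nlinarith
    calc ‖outerWeight x j ζ‖ ^ m * (1 / (8 * n : ℝ)) ^ 2
        ≤ ‖outerWeight x j ζ‖ ^ m * (1 - ‖ζ‖) ^ 2 := by gcongr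
      _ ≤ _ := h
      _ ≤ _ := by gcongr
  have h2 : ‖outerWeight x j ζ‖ ^ m ≤ (n : ℝ) ^ 8 * B * Real.exp (energyWeight x j) ^ m := by
    have e : ‖outerWeight x j ζ‖ ^ m =
        ‖outerWeight x j ζ‖ ^ m * (1 / (8 * n : ℝ)) ^ 2 * (64 * n ^ 2) := by field_simp; norm_num
    rw [e]
    have h3 : 5 * (n : ℝ) ^ 4 * (64 * n ^ 2) ≤ (n : ℝ) ^ 8 := by
      have : (320 : ℝ) ≤ n ^ 2 := by nlinarith
      calc 5 * (n : ℝ) ^ 4 * (64 * n ^ 2) = 320 * (n : ℝ) ^ 6 := by ring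
        _ ≤ n ^ 2 * (n : ℝ) ^ 6 := by gcongr
        _ = _ := by ring
    calc ‖outerWeight x j ζ‖ ^ m * (1 / (8 * n : ℝ)) ^ 2 * (64 * n ^ 2)
        ≤ 5 * (n : ℝ) ^ 4 * B * Real.exp (energyWeight x j) ^ m * (64 * n ^ 2) := by gcongr
      _ = 5 * (n : ℝ) ^ 4 * (64 * n ^ 2) * (B * Real.exp (energyWeight x j) ^ m) := by ring
      _ ≤ (n : ℝ) ^ 8 * (B * Real.exp (energyWeight x j) ^ m) := by gcongr
      _ = _ := by ring
  have h3 := Real.log_le_log (by positivity) h2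
  rw [Real.log_pow, Real.log_mul (by positivity) (by positivity),
    Real.log_mul (by positivity) (by positivity), Real.log_pow, Real.log_pow, Real.log_exp] at h3
  have h4 : Real.log B ≤ 2 * |x j| := by
    have h5 : Real.log B ≤ 2 * Real.log (1 + |x j|) := by
      rw [← Real.log_rpow (by positivity), Real.rpow_two]
      apply Real.log_le_log (by positivity)
      nlinarith [sq_abs (x j), abs_nonneg (x j)]
    linarith [Real.log_le_sub_one_of_pos (show 0 < 1 + |x j| by positivity)]
  rw [le_div_iff₀ hc₀]
  by_contra! hcon
  have hD : 0 < Real.log ‖outerWeight x j ζ‖ - energyWeight x j :=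
    pos_of_mul_pos_left ((by positivity : 0 < 16 + 4 * |x j|).trans hcon) hc₀.le
  have h6 := mul_le_mul_of_nonneg_right hm hD.le
  have h7 := mul_lt_mul_of_pos_right hcon (by linarith : 0 < Real.log n)
  have h8 : |x j| * 1 ≤ |x j| * Real.log n := by gcongr
  push_cast at h3
  nlinarith

/-- Configurations at which every one-point weight is comparable with its mean power are
quasi-Fekete. -/
theorem eventually_goodConfig {c₀ : ℝ} (hc₀ : 0 < c₀) :
    ∀ᶠ n : ℕ in atTop, ∀ m : ℕ, c₀ / 2 * Real.log n ≤ m → ∀ x : Fin n → ℝ,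
      Function.Injective x → (∀ j, ∫ t in -2..2, pointWeight x j t ^ m ≤
        (4 + (n : ℝ) ^ 4 * (1 + x j ^ 2)) * pointWeight x j (x j) ^ m) →
      GoodConfig (48 / c₀) x := by
  filter_upwards [eventually_ge_atTop 18, eventually_gt_atTop ⌈16 / c₀⌉₊] with n hn hn2 m hm x hx hI
  have hn' : (18 : ℝ) ≤ n := by exact_mod_cast hn
  have hn0 : (0 : ℝ) < n := by linarith
  have hnc := Nat.lt_of_ceil_lt hn2
  rw [div_lt_iff₀ hc₀] at hnc
  have hfield : ∀ j, ∀ z : ℂ, 1 / (2 * n : ℝ) ≤ z.im →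
      energyField x j z ≤ (16 + 4 * |x j|) / c₀ + energyWeight x j := by
    intro j z hz
    have hz0 : 0 < z.im := lt_of_lt_of_le (by positivity) hz
    have h1 : 1 / (8 * n : ℝ) ≤ 1 - ‖joukowskyInv z‖ := by
      refine le_trans (le_min ?_ ?_) (min_le_one_sub_norm_joukowskyInv hz0)
      · apply one_div_le_one_div_of_le <;> linarith
      · rw [le_div_iff₀ (by norm_num)]
        refine le_trans (le_of_eq ?_) hz
        field_simp; norm_num
    have h2 := log_outerWeight_le hx hc₀ hn hm (hI j) h1 (outerWeight_joukowskyInv_ne_zero x j hz0)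
    rw [energyField_eq_log_outerWeight x j hz0]
    linarith [Real.log_nonpos (norm_nonneg _) (norm_joukowskyInv_lt_one hz0).le]
  have hbdd : ∀ j, |x j| ≤ 8 := by
    intro j
    by_contra! hcon
    have h2n : 0 < 1 / (2 * n : ℝ) := by positivity
    have h2n' : 1 / (2 * n : ℝ) ≤ 1 := by
      rw [div_le_one (by positivity)]; linarith
    have h1 := hfield j ⟨x j, 1 / (2 * n)⟩ le_rfl
    have h2 := weight_le_field_add hx j (1 / (2 * n))
    have h3 := potential_le_norm_add_one (z := ⟨x j, 1 / (2 * n)⟩) h2n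
    have h4 : ‖(⟨x j, 1 / (2 * n)⟩ : ℂ)‖ ≤ |x j| + 1 := by
      have := norm_mk_sub_le (x j) 0 h2n.le
      simp only [Complex.ofReal_zero, sub_zero] at this
      linarith
    have h5 : (n : ℝ) * potential ⟨x j, 1 / (2 * n)⟩ ≤ n * (|x j| + 2) := by gcongr; linarith
    have h6 : n * ((x j) ^ 2 / 4 - |x j| - 3) ≤ (16 + 4 * |x j|) / c₀ := by nlinarith
    have h7 : |x j| / 2 + 1 ≤ (x j) ^ 2 / 4 - |x j| - 3 := by
      rw [← sq_abs]; nlinarith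
    have h8 : (n : ℝ) * (|x j| / 2 + 1) ≤ (16 + 4 * |x j|) / c₀ :=
      le_trans (by gcongr) h6
    rw [le_div_iff₀ hc₀] at h8
    nlinarith
  have hE : ∀ j, (16 + 4 * |x j|) / c₀ ≤ 48 / c₀ := fun j => by
    have := hbdd j
    gcongr; linarith
  refine ⟨by positivity, hx, hbdd, fun j => ?_, fun j z hz => ?_⟩
  · have h := log_outerWeight_le hx hc₀ hn hm (hI j) (ζ := 0)
      (by rw [norm_zero, sub_zero, div_le_one (by positivity)]; linarith)
      (by rw [outerWeight_zero]; exact one_ne_zero)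
    rw [outerWeight_zero, norm_one, Real.log_one] at h
    linarith [hE j]
  · linarith [hE j, hfield j z hz]

end Cauchy

section Density

variable {n : ℕ} {β : ℝ}

/-- The factor of the Gaussian density that does not depend on the coordinate `j`. -/
noncomputable def offDensity (β : ℝ) (x : Fin n → ℝ) (j : Fin n) : ℝ :=
  (∏ p ∈ (Finset.univ.filter fun p : Fin n × Fin n => p.1 < p.2).filter
      (fun p => ¬(p.1 = j ∨ p.2 = j)), |x p.1 - x p.2| ^ β) *
    Real.exp (-((n : ℝ) * β / 2) * ((∑ k ∈ Finset.univ.erase j, (x k) ^ 2 / 2) + 1))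

lemma prod_filter_incident (g : Fin n → Fin n → ℝ) (hg : ∀ a b, g a b = g b a) (j : Fin n) :
    ∏ p ∈ (Finset.univ.filter fun p : Fin n × Fin n => p.1 < p.2).filter
      (fun p => p.1 = j ∨ p.2 = j), g p.1 p.2 = ∏ k ∈ Finset.univ.erase j, g j k := by
  refine Finset.prod_bij' (fun p _ => if p.1 = j then p.2 else p.1)
    (fun k _ => if j < k then (j, k) else (k, j)) ?_ ?_ ?_ ?_ ?_
  · rintro ⟨a, b⟩ h
    simp only [Finset.mem_filter, Finset.mem_univ, true_and, Finset.mem_erase, and_true] at h ⊢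
    split_ifs <;> grind
  · intro k h
    simp only [Finset.mem_filter, Finset.mem_univ, true_and, Finset.mem_erase, and_true] at h ⊢
    split_ifs <;> grind
  · rintro ⟨a, b⟩ h
    simp only [Finset.mem_filter, Finset.mem_univ, true_and] at h ⊢
    grind
  · intro k h
    simp only [Finset.mem_erase, Finset.mem_univ, and_true] at h ⊢
    grind
  · rintro ⟨a, b⟩ h
    simp only [Finset.mem_filter, Finset.mem_univ, true_and] at h ⊢
    grind

lemma gaussianDensity_eq (β : ℝ) (x : Fin n → ℝ) (j : Fin n) :
    gaussianDensity n β x = offDensity β x j * pointWeight x j (x j) ^ β := by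
  rw [gaussianDensity, offDensity, pointWeight,
    ← Finset.prod_filter_mul_prod_filter_not _ (fun p : Fin n × Fin n => p.1 = j ∨ p.2 = j),
    prod_filter_incident (fun a b => |x a - x b| ^ β) (fun a b => by rw [abs_sub_comm]) j,
    Real.mul_rpow (Finset.prod_nonneg fun _ _ => abs_nonneg _) (Real.exp_pos _).le,
    Real.finsetProd_rpow _ _ (fun _ _ => abs_nonneg _), ← Real.exp_mul,
    ← Finset.sum_erase_add _ _ (Finset.mem_univ j)]
  have : Real.exp (-((n : ℝ) * β / 2) * (∑ k ∈ Finset.univ.erase j, x k ^ 2 / 2 + x j ^ 2 / 2)) =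
      Real.exp (-((n : ℝ) * β / 2) * ((∑ k ∈ Finset.univ.erase j, (x k) ^ 2 / 2) + 1)) *
        Real.exp (-(n * (x j ^ 2 / 4 - 1 / 2)) * β) := by
    rw [← Real.exp_add]; congr 1; ring
  rw [this]
  ring

lemma offDensity_update (β : ℝ) (x : Fin n → ℝ) (j : Fin n) (t : ℝ) :
    offDensity β (Function.update x j t) j = offDensity β x j := by
  rw [offDensity, offDensity]
  congr 1
  · refine Finset.prod_congr rfl fun p hp => ?_
    have := not_or.1 (Finset.mem_filter.1 hp).2
    rw [Function.update_of_ne this.1, Function.update_of_ne this.2]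
  · congr 3
    refine Finset.sum_congr rfl fun k hk => ?_
    rw [Function.update_of_ne (Finset.ne_of_mem_erase hk)]

lemma pointWeight_update (x : Fin n → ℝ) (j : Fin n) (t s : ℝ) :
    pointWeight (Function.update x j t) j s = pointWeight x j s := by
  rw [pointWeight, pointWeight]
  congr 1
  refine Finset.prod_congr rfl fun k hk => ?_
  rw [Function.update_of_ne (Finset.ne_of_mem_erase hk)]

lemma gaussianDensity_update (β : ℝ) (x : Fin n → ℝ) (j : Fin n) (t : ℝ) :
    gaussianDensity n β (Function.update x j t) = offDensity β x j * pointWeight x j t ^ β := by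
  rw [gaussianDensity_eq β _ j, offDensity_update, pointWeight_update, Function.update_self]

lemma offDensity_nonneg (β : ℝ) (x : Fin n → ℝ) (j : Fin n) : 0 ≤ offDensity β x j := by
  unfold offDensity; positivity

lemma gaussianDensity_nonneg (β : ℝ) (x : Fin n → ℝ) : 0 ≤ gaussianDensity n β x := by
  unfold gaussianDensity; positivity

lemma measurable_gaussianDensity (n : ℕ) (β : ℝ) : Measurable (gaussianDensity n β) := by
  unfold gaussianDensity; fun_prop

lemma injective_of_gaussianDensity_ne_zero (hβ : 0 < β) {x : Fin n → ℝ}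
    (h : gaussianDensity n β x ≠ 0) : Function.Injective x := by
  rw [gaussianDensity] at h
  have h1 := Finset.prod_ne_zero_iff.1 (left_ne_zero_of_mul h)
  have h2 : ∀ a b : Fin n, a < b → x a ≠ x b := by
    intro a b hab e
    apply h1 (a, b) (by simpa using hab)
    simp [e, Real.zero_rpow hβ.ne']
  intro a b e
  rcases lt_trichotomy a b with hab | hab | hab
  · exact absurd e (h2 a b hab)
  · exact hab
  · exact absurd e.symm (h2 b a hab)

/-- Comparison of the mean integer power of the one-point weight with the conditional partition
function. -/
lemma integral_pointWeight_pow_le (hβ : 0 < β) {x : Fin n → ℝ} {j : Fin n} {K : ℝ} (hK : 0 ≤ K)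
    (h0 : gaussianDensity n β x ≠ 0)
    (h : ∫⁻ t, ENNReal.ofReal (gaussianDensity n β (Function.update x j t)) ≤
      ENNReal.ofReal (K * gaussianDensity n β x)) :
    ∫ t in -2..2, pointWeight x j t ^ ⌊β⌋₊ ≤ (4 + K) * pointWeight x j (x j) ^ ⌊β⌋₊ := by
  have hpos : 0 < gaussianDensity n β x := lt_of_le_of_ne (gaussianDensity_nonneg β x) h0.symm
  have hA : 0 < offDensity β x j := by
    refine lt_of_le_of_ne (offDensity_nonneg β x j) fun e => h0 ?_
    rw [gaussianDensity_eq β x j, ← e, zero_mul]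
  set A := offDensity β x j
  have hw : 0 < pointWeight x j (x j) := by
    rw [pointWeight_self (injective_of_gaussianDensity_ne_zero hβ h0)]; exact Real.exp_pos _
  set w := pointWeight x j (x j)
  set m := ⌊β⌋₊
  have hc := continuous_pointWeight x j
  have hcm : Continuous fun t => (pointWeight x j t / w) ^ m := by fun_prop
  have key : ENNReal.ofReal (∫ t in -2..2, (pointWeight x j t / w) ^ m) ≤
      ENNReal.ofReal (4 + K) := by
    rw [intervalIntegral.integral_of_le (by norm_num),
      ofReal_integral_eq_lintegral_ofReal (hcm.integrableOn_Ioc)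
        (ae_of_all _ fun t => pow_nonneg (div_nonneg (pointWeight_nonneg x j t) hw.le) _)]
    calc ∫⁻ t in Set.Ioc (-2 : ℝ) 2, ENNReal.ofReal ((pointWeight x j t / w) ^ m)
        ≤ ∫⁻ t in Set.Ioc (-2 : ℝ) 2, (1 + ENNReal.ofReal (A * w ^ β)⁻¹ *
            ENNReal.ofReal (gaussianDensity n β (Function.update x j t))) := by
          refine lintegral_mono fun t => ?_
          rw [← ENNReal.ofReal_mul (by positivity), ← ENNReal.ofReal_one,
            ← ENNReal.ofReal_add zero_le_one (mul_nonneg (by positivity)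
              (gaussianDensity_nonneg _ _))]
          apply ENNReal.ofReal_le_ofReal
          rw [gaussianDensity_update]
          set q := pointWeight x j t / w with hq
          have hq0 : 0 ≤ q := div_nonneg (pointWeight_nonneg x j t) hw.le
          have e : (A * w ^ β)⁻¹ * (A * pointWeight x j t ^ β) = q ^ β := by
            rw [hq, Real.div_rpow (pointWeight_nonneg x j t) hw.le]
            have : 0 < w ^ β := by positivity
            change (A * w ^ β)⁻¹ * (A * pointWeight x j t ^ β) = _
            field_simp
          rw [e]
          rcases le_total q 1 with h1 | h1
          · have := pow_le_one₀ hq0 h1 (n := m)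
            have := Real.rpow_nonneg hq0 β
            linarith
          · have : q ^ m ≤ q ^ β := by
              rw [← Real.rpow_natCast]
              exact Real.rpow_le_rpow_of_exponent_le h1 (Nat.floor_le hβ.le)
            linarith
      _ = 4 + ENNReal.ofReal (A * w ^ β)⁻¹ * ∫⁻ t in Set.Ioc (-2 : ℝ) 2,
            ENNReal.ofReal (gaussianDensity n β (Function.update x j t)) := by
          rw [lintegral_add_left measurable_const, lintegral_const_mul' _ _ ENNReal.ofReal_ne_top]
          simp
          norm_num
      _ ≤ 4 + ENNReal.ofReal (A * w ^ β)⁻¹ * ENNReal.ofReal (K * gaussianDensity n β x) := by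
          gcongr
          exact (setLIntegral_le_lintegral _ _).trans h
      _ = ENNReal.ofReal (4 + K) := by
          have : 0 < w ^ β := by positivity
          rw [← ENNReal.ofReal_mul (by positivity), gaussianDensity_eq β x j,
            ENNReal.ofReal_add (by norm_num) hK]
          congr 2
          · norm_num
          · change (A * w ^ β)⁻¹ * (K * (A * w ^ β)) = K
            field_simp
  rw [ENNReal.ofReal_le_ofReal_iff (by positivity)] at key
  simp only [div_pow] at key
  rw [intervalIntegral.integral_div, div_le_iff₀ (by positivity)] at key
  exact key

end Density

section Fubini

variable {n : ℕ}

lemma measurable_lintegral_update {F : (Fin n → ℝ) → ℝ≥0∞} (hF : Measurable F) (j : Fin n) :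
    Measurable fun x : Fin n → ℝ => ∫⁻ t, F (Function.update x j t) := by
  have := hF.lmarginal (fun _ => (volume : Measure ℝ)) (s := {j})
  rwa [lmarginal_singleton] at this

/-- Integrating a slice integral against a function of the integrated-out coordinate. -/
lemma lintegral_slice_mul {F : (Fin n → ℝ) → ℝ≥0∞} (hF : Measurable F) {h : ℝ → ℝ≥0∞}
    (hh : Measurable h) (j : Fin n) :
    ∫⁻ x : Fin n → ℝ, (∫⁻ t, F (Function.update x j t)) * h (x j) =
      (∫⁻ t, h t) * ∫⁻ x, F x := by
  let ν : Fin n → Measure ℝ := fun _ => volume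
  have hS := measurable_lintegral_update hF j
  have hG : Measurable fun x : Fin n → ℝ =>
      (∫⁻ t, F (Function.update x j t)) * h (x j) :=
    hS.mul (hh.comp (measurable_pi_apply j))
  rw [volume_pi]
  rw [lintegral_eq_lmarginal_univ (μ := ν) 0, lintegral_eq_lmarginal_univ (μ := ν) 0,
    lmarginal_erase' _ hG (Finset.mem_univ j),
    lmarginal_erase' _ hF (Finset.mem_univ j)]
  simp only [Function.update_idem, Function.update_self]
  have e : ∀ x : Fin n → ℝ, ∫⁻ s, (∫⁻ t, F (Function.update x j t)) * h s ∂(ν j) =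
      (∫⁻ t, h t) * ∫⁻ t, F (Function.update x j t) := fun x => by
    rw [lintegral_const_mul _ hh, mul_comm]
  simp only [e]
  simp only [lmarginal]
  rw [lintegral_const_mul]
  exact hS.comp (measurable_updateFinset)

end Fubini

section BadEvent

variable {n : ℕ} {β Z : ℝ}

/-- The configurations at which the conditional density of the coordinate `j` is exceptionally
small compared with its total mass. -/
def sliceExceptional (β : ℝ) (j : Fin n) : Set (Fin n → ℝ) :=
  {x | ENNReal.ofReal ((n : ℝ) ^ 4 * (1 + x j ^ 2) * gaussianDensity n β x) <
    ∫⁻ t, ENNReal.ofReal (gaussianDensity n β (Function.update x j t))}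

lemma measurableSet_sliceExceptional (β : ℝ) (j : Fin n) :
    MeasurableSet (sliceExceptional β j) := by
  have := measurable_gaussianDensity n β
  exact measurableSet_lt (by fun_prop) (measurable_lintegral_update this.ennreal_ofReal j)

lemma measure_sliceExceptional_le (hZ : 0 < Z) {ν : Measure (Fin n → ℝ)}
    (hν : ν = volume.withDensity fun x => ENNReal.ofReal (gaussianDensity n β x / Z))
    [IsProbabilityMeasure ν] (j : Fin n) :
    ν (sliceExceptional β j) ≤ ENNReal.ofReal (Real.pi / (n : ℝ) ^ 4) := by
  have hn : 0 < (n : ℝ) := by exact_mod_cast j.pos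
  have hD := measurable_gaussianDensity n β
  set F : (Fin n → ℝ) → ℝ≥0∞ := fun x => ENNReal.ofReal (gaussianDensity n β x / Z) with hF
  have hFm : Measurable F := (hD.div_const Z).ennreal_ofReal
  have hF1 : ∫⁻ x, F x = 1 := by
    have : ν Set.univ = 1 := measure_univ
    rwa [hν, withDensity_apply _ MeasurableSet.univ, setLIntegral_univ] at this
  set h : ℝ → ℝ≥0∞ := fun s => ENNReal.ofReal (((n : ℝ) ^ 4)⁻¹ * (1 + s ^ 2)⁻¹) with hh
  have hhm : Measurable h := by fun_prop
  have hint : ∫⁻ s, h s = ENNReal.ofReal (Real.pi / (n : ℝ) ^ 4) := by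
    rw [hh, ← ofReal_integral_eq_lintegral_ofReal (integrable_inv_one_add_sq.const_mul _)
      (ae_of_all _ fun s => by positivity), integral_const_mul, integral_univ_inv_one_add_sq]
    congr 1; ring
  rw [hν, withDensity_apply _ (measurableSet_sliceExceptional β j)]
  calc ∫⁻ x in sliceExceptional β j, F x
      ≤ ∫⁻ x in sliceExceptional β j, (∫⁻ t, F (Function.update x j t)) * h (x j) := by
        refine setLIntegral_mono' (measurableSet_sliceExceptional β j) fun x hx => ?_
        have hx' : ENNReal.ofReal ((n : ℝ) ^ 4 * (1 + x j ^ 2) * gaussianDensity n β x) ≤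
          ∫⁻ t, ENNReal.ofReal (gaussianDensity n β (Function.update x j t)) := le_of_lt hx
        have e : ∫⁻ t, F (Function.update x j t) = ENNReal.ofReal Z⁻¹ *
            ∫⁻ t, ENNReal.ofReal (gaussianDensity n β (Function.update x j t)) := by
          rw [← lintegral_const_mul' _ _ ENNReal.ofReal_ne_top]
          refine lintegral_congr fun t => ?_
          rw [← ENNReal.ofReal_mul (by positivity), ← div_eq_inv_mul]
        rw [e]
        refine le_trans (le_of_eq ?_) (mul_le_mul_left (mul_le_mul_right hx' _) _)
        rw [hF, hh, ← ENNReal.ofReal_mul (by positivity), ← ENNReal.ofReal_mul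
          (mul_nonneg (by positivity) (mul_nonneg (by positivity) (gaussianDensity_nonneg β x)))]
        have : 0 < 1 + x j ^ 2 := by positivity
        field_simp
    _ ≤ ∫⁻ x, (∫⁻ t, F (Function.update x j t)) * h (x j) := setLIntegral_le_lintegral _ _
    _ = ENNReal.ofReal (Real.pi / (n : ℝ) ^ 4) := by
        rw [lintegral_slice_mul hFm hhm, hint, hF1, mul_one]

/-- The configurations excluded in the Borel-Cantelli argument. -/
def exceptional (n : ℕ) (β : ℝ) : Set (Fin n → ℝ) :=
  {x | gaussianDensity n β x = 0} ∪ ⋃ j, sliceExceptional β j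

lemma measurableSet_exceptional (n : ℕ) (β : ℝ) : MeasurableSet (exceptional n β) :=
  (measurable_gaussianDensity n β (measurableSet_singleton 0)).union
    (MeasurableSet.iUnion fun j => measurableSet_sliceExceptional β j)

lemma measure_exceptional_le (hZ : 0 < Z) {ν : Measure (Fin n → ℝ)}
    (hν : ν = volume.withDensity fun x => ENNReal.ofReal (gaussianDensity n β x / Z))
    [IsProbabilityMeasure ν] :
    ν (exceptional n β) ≤ ENNReal.ofReal (Real.pi * (1 / (n : ℝ) ^ 3)) := by
  have h0 : ν {x | gaussianDensity n β x = 0} = 0 := by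
    have hm : MeasurableSet {x | gaussianDensity n β x = 0} :=
      measurable_gaussianDensity n β (measurableSet_singleton 0)
    rw [hν, withDensity_apply _ hm]
    refine (setLIntegral_congr_fun (g := fun _ => 0) hm fun x hx => ?_).trans (by simp)
    have hx : gaussianDensity n β x = 0 := hx
    simp [hx]
  calc ν (exceptional n β)
      ≤ ν {x | gaussianDensity n β x = 0} + ν (⋃ j, sliceExceptional β j) := measure_union_le _ _
    _ ≤ 0 + ∑ j : Fin n, ν (sliceExceptional β j) := by
        rw [h0]; gcongr; exact measure_iUnion_fintype_le _ _
    _ ≤ 0 + ∑ _j : Fin n, ENNReal.ofReal (Real.pi / (n : ℝ) ^ 4) := by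
        gcongr with j; exact measure_sliceExceptional_le hZ hν j
    _ = ENNReal.ofReal (Real.pi * (1 / (n : ℝ) ^ 3)) := by
        rw [zero_add, Finset.sum_const, Finset.card_univ, Fintype.card_fin, nsmul_eq_mul,
          ← ENNReal.ofReal_natCast, ← ENNReal.ofReal_mul (by positivity)]
        congr 1
        rcases eq_or_ne (n : ℝ) 0 with e | e
        · simp [e]
        · field_simp

end BadEvent

lemma goodConfig_of_notMem_exceptional {β : ℕ → ℝ} (hβpos : ∀ n, 0 < β n) {c₀ : ℝ} (hc₀ : 0 < c₀)
    (hfreeze : ∀ᶠ n : ℕ in atTop, c₀ * Real.log n ≤ β n) :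
    ∀ᶠ n : ℕ in atTop, ∀ x : Fin n → ℝ, x ∉ exceptional n (β n) → GoodConfig (48 / c₀) x := by
  have hlog : ∀ᶠ n : ℕ in atTop, 1 ≤ c₀ / 2 * Real.log n :=
    ((Real.tendsto_log_atTop.comp tendsto_natCast_atTop_atTop).const_mul_atTop
      (by positivity)).eventually_ge_atTop 1
  filter_upwards [eventually_goodConfig hc₀, hfreeze, hlog] with n hgood hn h1 x hx
  simp only [exceptional, Set.mem_union, Set.mem_iUnion, not_or, not_exists] at hx
  refine hgood ⌊β n⌋₊ ?_ x (injective_of_gaussianDensity_ne_zero (hβpos n) hx.1) fun j =>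
    integral_pointWeight_pow_le (hβpos n) (by positivity) hx.1 (not_lt.1 (hx.2 j))
  have := Nat.lt_floor_add_one (β n)
  linarith

/-- Bulk Beurling-Landau densities equal the semicircle law in the perfect freezing regime,
with uniformity in the bulk point. -/
theorem bulk_equidistribution
    (β : ℕ → ℝ) (hβpos : ∀ n, 0 < β n)
    (c₀ : ℝ) (hc₀ : 0 < c₀)
    (hfreeze : ∀ᶠ n : ℕ in atTop, c₀ * Real.log n ≤ β n)
    (Z : ℕ → ℝ) (hZ : ∀ n, 0 < Z n)
    (μ : (n : ℕ) → Measure (Fin n → ℝ))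
    (hμ : ∀ n, μ n =
      volume.withDensity (fun x => ENNReal.ofReal (gaussianDensity n (β n) x / Z n)))
    (hμprob : ∀ n, IsProbabilityMeasure (μ n))
    (P : Measure ((n : ℕ) → Fin n → ℝ)) (hPprob : IsProbabilityMeasure P)
    (hP : ∀ (S : Finset ℕ) (A : (n : ℕ) → Set (Fin n → ℝ)),
      (∀ n ∈ S, MeasurableSet (A n)) →
      P {ω | ∀ n ∈ S, ω n ∈ A n} = ∏ n ∈ S, μ n (A n))
    :
    ∀ᵐ ω ∂P,
      (∀ x ∈ Set.Ioo (-2 : ℝ) 2,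
        Tendsto (fun L : ℝ => Filter.limsup
            (fun n : ℕ => (countIn n (ω n) (Set.Ioo (x - L / n) (x + L / n)) : ℝ) / (2 * L))
            atTop) atTop (nhds (semicircle x)) ∧
        Tendsto (fun L : ℝ => Filter.liminf
            (fun n : ℕ => (countIn n (ω n) (Set.Ioo (x - L / n) (x + L / n)) : ℝ) / (2 * L))
            atTop) atTop (nhds (semicircle x))) ∧
      TendstoUniformlyOn
        (fun (L : ℝ) (x : ℝ) => Filter.limsup
          (fun n : ℕ => (countIn n (ω n) (Set.Ioo (x - L / n) (x + L / n)) : ℝ) / (2 * L)) atTop)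
        semicircle atTop (Set.Ioo (-2 : ℝ) 2) ∧
      TendstoUniformlyOn
        (fun (L : ℝ) (x : ℝ) => Filter.liminf
          (fun n : ℕ => (countIn n (ω n) (Set.Ioo (x - L / n) (x + L / n)) : ℝ) / (2 * L)) atTop)
        semicircle atTop (Set.Ioo (-2 : ℝ) 2) := by
  have hbad : ∀ n, P {ω | ω n ∈ exceptional n (β n)} ≤
      ENNReal.ofReal (Real.pi * (1 / (n : ℝ) ^ 3)) := fun n => by
    have hn := hP {n} (fun m => exceptional m (β m)) fun m _ => measurableSet_exceptional m (β m)
    simp only [Finset.mem_singleton, forall_eq, Finset.prod_singleton] at hn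
    have := hμprob n
    rw [hn]
    exact measure_exceptional_le (hZ n) (hμ n)
  have hsum : ∑' n, P {ω | ω n ∈ exceptional n (β n)} ≠ ⊤ := by
    refine ne_top_of_le_ne_top ?_ (ENNReal.tsum_le_tsum hbad)
    exact ((Real.summable_one_div_nat_pow.2 (by norm_num)).mul_left Real.pi).tsum_ofReal_ne_top
  have hae : ∀ᵐ ω ∂P, ∀ᶠ n in atTop, ω n ∉ exceptional n (β n) := by
    have := measure_setOfPred_frequently_eq_zero hsum
    rw [ae_iff]
    simpa only [Filter.not_eventually, not_not] using this
  filter_upwards [hae] with ω hω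
  have hg : ∀ᶠ n in atTop, GoodConfig (48 / c₀) (ω n) := by
    filter_upwards [hω, goodConfig_of_notMem_exceptional hβpos hc₀ hfreeze] with n h1 h2
    exact h2 _ h1
  obtain ⟨hsup, hinf⟩ := density_of_goodConfig hg
  exact ⟨fun x hx => ⟨hsup.tendsto_at hx, hinf.tendsto_at hx⟩, hsup, hinf⟩
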